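/- Let L/K be as in the Artin–Schreier–Witt setting (cyclic totally ramified of degree p^n, defined by the Witt vector u with pole orders ν_i prime to p). Then the conductor exponent of L/K equals the maximum of the numbers p^{n-1-i}·ν_i for 0 ≤ i ≤ n−1; that is, m(L/K) = max_{0≤i≤n−1} p^{n−1−i} ν_i. -/

import Mathlib

set_option synthInstance.maxHeartbeats 1000000
set_option maxHeartbeats 1600000

/-- The Frobenius on truncated Witt vectors over a ring of characteristic `p`: it raises
each component to the `p`-th power. -/
noncomputable def twFrobenius (p m : ℕ) {R : Type*} [CommRing R]
    (x : TruncatedWittVector p m R) : TruncatedWittVector p m R :=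
  TruncatedWittVector.mk p fun i => x.coeff i ^ p

/-- Componentwise application of a ring homomorphism to a truncated Witt vector. -/
noncomputable def twMap (p m : ℕ) {R S : Type*} [CommRing R] [CommRing S]
    (f : R →+* S) (x : TruncatedWittVector p m R) : TruncatedWittVector p m S :=
  TruncatedWittVector.mk p fun i => f (x.coeff i)

/-- A (rank-one) additive valuation on a field, written additively with value `⊤` at `0`. -/
def IsAddValuation {L : Type*} [Field L] (v : L → WithTop ℤ) : Prop :=
  (∀ x, v x = ⊤ ↔ x = 0) ∧ (∀ x y, v (x * y) = v x + v y) ∧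
    (∀ x y, min (v x) (v y) ≤ v (x + y))

/-- The `i`-th lower ramification group `G_i = {σ : v(σt − t) ≥ i + 1}` of a Galois extension
`L/K`, computed with respect to a valuation `v` and a uniformizer `t` of `L`. -/
def ramGroup {K L : Type*} [Field K] [Field L] [Algebra K L] (v : L → WithTop ℤ) (t : L)
    (i : ℕ) : Set (L ≃ₐ[K] L) :=
  {σ | (((i : ℤ) + 1 : ℤ) : WithTop ℤ) ≤ v (σ t - t)}

section Valuation

variable {L : Type*} [Field L] (v : AddValuation L (WithTop ℤ))

/-- `x` has valuation at least `a`. -/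
def ValGE (a : ℤ) (x : L) : Prop := (a : WithTop ℤ) ≤ v x

/-- `x` has valuation exactly `a`. -/
def ValEq (a : ℤ) (x : L) : Prop := v x = (a : WithTop ℤ)

variable {v} {a b : ℤ} {x y : L}

lemma ValEq.ge (h : ValEq v a x) : ValGE v a x := by
  rw [ValGE, h]

lemma ValGE.mono (h : ValGE v a x) (hb : b ≤ a) : ValGE v b x :=
  le_trans (WithTop.coe_le_coe.2 hb) h

lemma ValEq.congr (h : ValEq v a x) (hb : a = b) : ValEq v b x := hb ▸ h

lemma ValGE.zero : ValGE v a 0 := by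
  simp [ValGE]

lemma ValGE.add (hx : ValGE v a x) (hy : ValGE v a y) : ValGE v a (x + y) :=
  v.map_le_add hx hy

lemma ValGE.sub (hx : ValGE v a x) (hy : ValGE v a y) : ValGE v a (x - y) :=
  v.map_le_sub hx hy

lemma ValGE.neg (hx : ValGE v a x) : ValGE v a (-x) := by
  rwa [ValGE, AddValuation.map_neg]

lemma ValGE.sum {ι : Type*} {s : Finset ι} {f : ι → L} (h : ∀ i ∈ s, ValGE v a (f i)) :
    ValGE v a (∑ i ∈ s, f i) :=
  v.map_le_sum h

lemma ValGE.mul (hx : ValGE v a x) (hy : ValGE v b y) : ValGE v (a + b) (x * y) := by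
  rw [ValGE, AddValuation.map_mul, WithTop.coe_add]
  exact add_le_add hx hy

lemma ValEq.mul (hx : ValEq v a x) (hy : ValEq v b y) : ValEq v (a + b) (x * y) := by
  rw [ValEq, AddValuation.map_mul, WithTop.coe_add, hx, hy]

lemma ValEq.one : ValEq v 0 1 := v.map_one

lemma ValGE.one : ValGE v 0 1 := ValEq.one.ge

lemma ValEq.neg (hx : ValEq v a x) : ValEq v a (-x) := by
  rwa [ValEq, AddValuation.map_neg]

lemma ValGE.pow (hx : ValGE v a x) (k : ℕ) : ValGE v (k * a) (x ^ k) := by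
  induction k with
  | zero => simpa using ValGE.one
  | succ k ih => rw [pow_succ]; exact (ih.mul hx).mono (by push_cast; linarith)

lemma ValEq.pow (hx : ValEq v a x) (k : ℕ) : ValEq v (k * a) (x ^ k) := by
  induction k with
  | zero => simpa using ValEq.one
  | succ k ih => rw [pow_succ]; exact (ih.mul hx).congr (by push_cast; ring)

lemma ValEq.ne_zero (h : ValEq v a x) : x ≠ 0 := by
  rintro rfl
  simp [ValEq] at h

lemma ValEq.unique (h : ValEq v a x) (h' : ValEq v b x) : a = b :=
  WithTop.coe_injective (h.symm.trans h')

lemma ValEq.le (h : ValEq v a x) (h' : ValGE v b x) : b ≤ a := by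
  rw [ValGE, h] at h'
  exact WithTop.coe_le_coe.1 h'

lemma ValEq.exists (v : AddValuation L (WithTop ℤ)) (h : x ≠ 0) : ∃ a, ValEq v a x := by
  obtain ⟨a, ha⟩ := WithTop.ne_top_iff_exists.1 ((v.ne_top_iff).2 h)
  exact ⟨a, ha.symm⟩

lemma ValEq.inv (h : ValEq v a x) : ValEq v (-a) x⁻¹ := by
  obtain ⟨b, hb⟩ := ValEq.exists v (inv_ne_zero h.ne_zero)
  have := h.mul hb
  rw [mul_inv_cancel₀ h.ne_zero] at this
  exact hb.congr (by linarith [this.unique ValEq.one])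

lemma ValEq.div (hx : ValEq v a x) (hy : ValEq v b y) : ValEq v (a - b) (x / y) := by
  rw [div_eq_mul_inv, sub_eq_add_neg]
  exact hx.mul hy.inv

lemma ValEq.zpow (hx : ValEq v a x) (k : ℤ) : ValEq v (k * a) (x ^ k) := by
  cases k with
  | ofNat k => simpa using hx.pow k
  | negSucc k =>
    rw [zpow_negSucc]
    exact (hx.pow (k + 1)).inv.congr (by push_cast [Int.negSucc_eq]; ring)

lemma ValGE.eq_or (h : ValGE v a x) : ValEq v a x ∨ ValGE v (a + 1) x := by
  by_cases hx : x = 0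
  · exact Or.inr (hx ▸ ValGE.zero)
  · obtain ⟨b, hb⟩ := ValEq.exists v hx
    rcases (hb.le h).eq_or_lt with h' | h'
    · exact Or.inl (hb.congr h'.symm)
    · exact Or.inr (hb.ge.mono h')

lemma ValEq.add (hx : ValEq v a x) (hy : ValGE v (a + 1) y) : ValEq v a (x + y) := by
  rcases (hx.ge.add (hy.mono (by linarith))).eq_or with h | h
  · exact h
  · have := h.sub hy
    rw [add_sub_cancel_right] at this
    linarith [hx.le this]

lemma ValEq.sub (hx : ValEq v a x) (hy : ValGE v (a + 1) y) : ValEq v a (x - y) := by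
  rw [sub_eq_add_neg]
  exact hx.add hy.neg

lemma ValGE.of_pow {k : ℕ} (hk : 0 < k) (h : ValGE v (k * a) (x ^ k)) : ValGE v a x := by
  by_cases hx : x = 0
  · exact hx ▸ ValGE.zero
  obtain ⟨b, hb⟩ := ValEq.exists v hx
  have := (hb.pow k).le h
  exact hb.ge.mono (le_of_mul_le_mul_left this (by exact_mod_cast hk))

lemma ValGE.intCast (k : ℤ) : ValGE v 0 (k : L) := by
  have hn : ∀ m : ℕ, ValGE v 0 (m : L) := fun m => by
    induction m with
    | zero => simpa using ValGE.zero
    | succ m ih => push_cast; exact ih.add ValGE.one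
  cases k with
  | ofNat k => simpa using hn k
  | negSucc k => simpa using (hn (k + 1)).neg

lemma ValEq.intCast (p : ℕ) [Fact p.Prime] [CharP L p] {k : ℤ} (hk : ¬ (p : ℤ) ∣ k) :
    ValEq v 0 (k : L) := by
  have hc : IsCoprime (p : ℤ) k :=
    (Prime.coprime_iff_not_dvd (Nat.prime_iff_prime_int.1 Fact.out)).2 hk
  obtain ⟨a, b, h⟩ := hc
  have h1 : (b : L) * (k : L) = 1 := by
    have := congrArg (Int.cast : ℤ → L) h
    simpa using this
  rcases (ValGE.intCast (v := v) k).eq_or with h2 | h2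
  · exact h2
  · have := (ValGE.intCast (v := v) b).mul h2
    rw [h1] at this
    linarith [ValEq.one.le this]

/-- A finite sum of terms of pairwise distinct valuations has the smallest of these as its
valuation: here the term at `j` is strictly dominant. -/
lemma ValEq.sum_of_dominant {ι : Type*} {s : Finset ι} {f : ι → L} {j : ι} (hj : j ∈ s)
    (hfj : ValEq v a (f j)) (h : ∀ i ∈ s, i ≠ j → ValGE v (a + 1) (f i)) :
    ValEq v a (∑ i ∈ s, f i) := by
  classical
  rw [← Finset.add_sum_erase s f hj]
  exact hfj.add (ValGE.sum fun i hi =>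
    h i (Finset.mem_of_mem_erase hi) (Finset.ne_of_mem_erase hi))

/-- A finite sum, not all of whose terms vanish, whose nonzero terms have pairwise distinct
valuations, has a dominant term. -/
lemma exists_dominant {ι : Type*} {s : Finset ι} {f : ι → L}
    (hd : ∀ i ∈ s, ∀ j ∈ s, i ≠ j → f i ≠ 0 → f j ≠ 0 → v (f i) ≠ v (f j))
    (h0 : ∃ i ∈ s, f i ≠ 0) :
    ∃ j ∈ s, ∃ a, ValEq v a (f j) ∧ (∀ i ∈ s, i ≠ j → ValGE v (a + 1) (f i)) ∧
      ValEq v a (∑ i ∈ s, f i) := by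
  obtain ⟨i₀, hi₀, hne⟩ := h0
  obtain ⟨j, hj, hmin⟩ := Finset.exists_min_image s (fun i => v (f i)) ⟨i₀, hi₀⟩
  have hfj : f j ≠ 0 := by
    intro h
    have := hmin i₀ hi₀
    rw [h, AddValuation.map_zero, top_le_iff, v.top_iff] at this
    exact hne this
  obtain ⟨a, ha⟩ := ValEq.exists v hfj
  have hdom : ∀ i ∈ s, i ≠ j → ValGE v (a + 1) (f i) := by
    intro i hi hij
    have hge : ValGE v a (f i) := by
      have := hmin i hi
      rwa [ha] at this
    rcases hge.eq_or with h | h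
    · exact absurd (h.trans ha.symm) (hd i hi j hj hij h.ne_zero hfj)
    · exact h
  exact ⟨j, hj, a, ha, hdom, ValEq.sum_of_dominant hj ha hdom⟩

/-- The valuation ring of `v`. -/
def valSubring (v : AddValuation L (WithTop ℤ)) : Subring L where
  carrier := {x | ValGE v 0 x}
  mul_mem' hx hy := by simpa using ValGE.mul hx hy
  one_mem' := ValGE.one
  add_mem' := ValGE.add
  zero_mem' := ValGE.zero
  neg_mem' := ValGE.neg

lemma mem_valSubring : x ∈ valSubring v ↔ ValGE v 0 x := Iff.rfl

end Valuation

section Witt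

open WittVector

variable {p : ℕ} [Fact p.Prime]

lemma witt_eq_teichmuller_add_verschiebung {R : Type*} [CommRing R] (x : WittVector p R) :
    x = teichmuller p (x.coeff 0) + verschiebung (x.shift 1) := by
  ext i
  rw [coeff_add_of_disjoint]
  · cases i with
    | zero => simp
    | succ i =>
      rw [teichmuller_coeff_pos _ _ _ (Nat.succ_pos i), verschiebung_coeff_succ, shift_coeff,
        zero_add, add_comm]
  · intro i
    cases i with
    | zero => right; simp
    | succ i => left; simp [teichmuller_coeff_pos]

lemma frobenius_teichmuller_charP {R : Type*} [CommRing R] [CharP R p] (a : R) :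
    frobenius (teichmuller p a) = teichmuller p (a ^ p) := by
  ext i
  rw [coeff_frobenius_charP]
  cases i with
  | zero => rw [teichmuller_coeff_zero, teichmuller_coeff_zero]
  | succ i =>
    rw [teichmuller_coeff_pos _ _ _ (Nat.succ_pos i), teichmuller_coeff_pos _ _ _ (Nat.succ_pos i),
      zero_pow (Fact.out : p.Prime).ne_zero]

lemma teichmuller_mul_coeff_charP {R : Type*} [CommRing R] [CharP R p] (a : R)
    (x : WittVector p R) (i : ℕ) :
    (teichmuller p a * x).coeff i = a ^ p ^ i * x.coeff i := by
  induction i generalizing a x with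
  | zero => simp [mul_coeff_zero]
  | succ i ih =>
    have h : teichmuller p a * x =
        teichmuller p (a * x.coeff 0) + verschiebung (teichmuller p (a ^ p) * x.shift 1) := by
      conv_lhs => rw [witt_eq_teichmuller_add_verschiebung x, mul_add, ← map_mul]
      rw [mul_comm (teichmuller p a) (verschiebung _), ← verschiebung_mul_frobenius,
        frobenius_teichmuller_charP, mul_comm (x.shift 1)]
    rw [h, coeff_add_of_disjoint, teichmuller_coeff_pos _ _ _ (Nat.succ_pos i),
      verschiebung_coeff_succ, ih, shift_coeff, zero_add, ← pow_mul, ← pow_succ', add_comm 1 i]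
    intro j
    cases j with
    | zero => right; simp
    | succ j => left; exact teichmuller_coeff_pos _ _ _ (Nat.succ_pos j)

lemma truncate_eq_iff {R : Type*} [CommRing R] {r : ℕ} {x y : WittVector p R} :
    truncate r x = truncate r y ↔ ∀ i < r, x.coeff i = y.coeff i := by
  rw [TruncatedWittVector.ext_iff]
  simp only [coeff_truncate]
  exact Fin.forall_iff

lemma truncate_eq_of_le {R : Type*} [CommRing R] {r s : ℕ} (h : s ≤ r) {x y : WittVector p R}
    (hxy : truncate r x = truncate r y) : truncate s x = truncate s y :=
  truncate_eq_iff.2 fun i hi => truncate_eq_iff.1 hxy i (hi.trans_le h)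

/-- The Witt vectors all of whose components lie in a given subring. -/
noncomputable def wittSubring {L : Type*} [CommRing L] (p : ℕ) [Fact p.Prime] (R : Subring L) :
    Subring (WittVector p L) :=
  (WittVector.map (p := p) R.subtype).range

lemma mem_wittSubring {L : Type*} [CommRing L] {R : Subring L} {x : WittVector p L} :
    x ∈ wittSubring p R ↔ ∀ i, x.coeff i ∈ R := by
  constructor
  · rintro ⟨y, rfl⟩ i
    rw [map_coeff]
    exact (y.coeff i).2
  · intro h
    exact ⟨WittVector.mk p fun i => ⟨x.coeff i, h i⟩, by ext i; simp [map_coeff]⟩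

lemma coeff_sub_mem_subring {L : Type*} [CommRing L] (R : Subring L) {r : ℕ}
    {x y : WittVector p L} (hx : ∀ i < r, x.coeff i ∈ R) (hy : ∀ i < r, y.coeff i ∈ R) :
    ∀ i < r, (x - y).coeff i ∈ R := by
  have key : ∀ z : WittVector p L, (∀ i < r, z.coeff i ∈ R) →
      ∃ z' ∈ wittSubring p R, truncate r z = truncate r z' := by
    intro z hz
    refine ⟨WittVector.mk p fun i => if i < r then z.coeff i else 0, ?_, ?_⟩
    · refine mem_wittSubring.2 fun i => ?_
      by_cases h : i < r
      · simpa [h] using hz i h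
      · simp [h]
    · refine truncate_eq_iff.2 fun i hi => ?_
      simp [hi]
  obtain ⟨x', hx', hxx⟩ := key x hx
  obtain ⟨y', hy', hyy⟩ := key y hy
  intro i hi
  have h : truncate r (x - y) = truncate r (x' - y') := by rw [map_sub, map_sub, hxx, hyy]
  rw [truncate_eq_iff.1 h i hi]
  exact mem_wittSubring.1 (sub_mem hx' hy') i

lemma frobenius_mem_wittSubring {L : Type*} [CommRing L] [CharP L p] {R : Subring L}
    {x : WittVector p L} (hx : x ∈ wittSubring p R) : frobenius x ∈ wittSubring p R := by
  refine mem_wittSubring.2 fun i => ?_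
  rw [coeff_frobenius_charP]
  exact pow_mem (mem_wittSubring.1 hx i) p

lemma teichmuller_mem_wittSubring {L : Type*} [CommRing L] {R : Subring L}
    {a : L} (ha : a ∈ R) : teichmuller p a ∈ wittSubring p R :=
  ⟨teichmuller p ⟨a, ha⟩, map_teichmuller p _ _⟩

lemma verschiebung_mem_wittSubring {L : Type*} [CommRing L] {R : Subring L}
    {x : WittVector p L} (hx : x ∈ wittSubring p R) : verschiebung x ∈ wittSubring p R := by
  obtain ⟨y, rfl⟩ := hx
  exact ⟨verschiebung y, map_verschiebung _ _⟩

lemma coeff_add_verschiebung_iterate_of_lt {R : Type*} [CommRing R] (x z : WittVector p R)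
    {i j : ℕ} (h : i < j) : (x + verschiebung^[j] z).coeff i = x.coeff i := by
  have : truncate j (x + verschiebung^[j] z) = truncate j x := by
    rw [map_add, add_eq_left, ← RingHom.mem_ker, mem_ker_truncate]
    exact fun i hi => iterate_verschiebung_coeff_eq_zero z hi
  exact truncate_eq_iff.1 this i h

lemma iterate_verschiebung_add {R : Type*} [CommRing R] (x y : WittVector p R) (j : ℕ) :
    verschiebung^[j] (x + y) = verschiebung^[j] x + verschiebung^[j] y := by
  induction j generalizing x y with
  | zero => rfl
  | succ j ih => simp only [Function.iterate_succ_apply, map_add, ih]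

lemma tail_eq_iterate_verschiebung {R : Type*} [CommRing R] (x : WittVector p R) (j : ℕ) :
    tail j x = verschiebung^[j] (x.shift j) := by
  ext i
  by_cases h : j ≤ i
  · rw [show (tail j x).coeff i = x.coeff i from if_pos h]
    obtain ⟨k, rfl⟩ := Nat.exists_eq_add_of_le h
    rw [add_comm j k, iterate_verschiebung_coeff, shift_coeff, add_comm]
  · rw [iterate_verschiebung_coeff_eq_zero _ (not_le.1 h)]
    exact if_neg h

lemma coeff_add_verschiebung_iterate_self {R : Type*} [CommRing R] (x z : WittVector p R)
    (j : ℕ) : (x + verschiebung^[j] z).coeff j = x.coeff j + z.coeff 0 := by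
  have h : x + verschiebung^[j] z = WittVector.init j x + verschiebung^[j] (x.shift j + z) := by
    conv_lhs => rw [← init_add_tail x j]
    rw [tail_eq_iterate_verschiebung, add_assoc, iterate_verschiebung_add]
  rw [h, coeff_add_of_disjoint]
  · have := iterate_verschiebung_coeff (x.shift j + z) j 0
    rw [zero_add] at this
    have h0 : (WittVector.init j x).coeff j = 0 := if_neg (lt_irrefl j)
    rw [this, add_coeff_zero, shift_coeff, h0]
    simp
  · intro i
    by_cases hi : i < j
    · right
      exact iterate_verschiebung_coeff_eq_zero _ hi
    · left
      exact if_neg hi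

/-- The logarithmic-type differential `F^{r-1} d` on Witt vectors, contracted with a
derivation `θ`: it sends `x` to `∑ x_i ^ (p ^ (r - 1 - i) - 1) θ (x_i)`. -/
noncomputable def wittDer {R : Type*} [CommRing R] (θ : Derivation ℤ R R) (r : ℕ)
    (x : WittVector p R) : R :=
  ∑ i ∈ Finset.range r, x.coeff i ^ (p ^ (r - 1 - i) - 1) * θ (x.coeff i)

lemma derivation_ghostComponent {R : Type*} [CommRing R] (θ : Derivation ℤ R R) (r : ℕ)
    (x : WittVector p R) :
    θ (ghostComponent r x) = (p : R) ^ r * wittDer θ (r + 1) x := by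
  rw [ghostComponent_apply, wittPolynomial_eq_sum_C_mul_X_pow, map_sum, map_sum, wittDer,
    Finset.mul_sum]
  refine Finset.sum_congr rfl fun i hi => ?_
  have hir : i ≤ r := Nat.lt_succ_iff.1 (Finset.mem_range.1 hi)
  have e : (p : R) ^ r = (p : R) ^ i * (p : R) ^ (r - i) := by
    rw [← pow_add, Nat.add_sub_cancel' hir]
  simp only [map_mul, map_pow, MvPolynomial.aeval_X, Derivation.leibniz, Derivation.leibniz_pow,
    add_tsub_cancel_right, map_natCast, smul_eq_mul, nsmul_eq_mul]
  rw [e]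
  push_cast
  simp [mul_assoc]

lemma wittDer_map {R S : Type*} [CommRing R] [CommRing S] (θ : Derivation ℤ R R)
    (η : Derivation ℤ S S) (f : R →+* S) (h : ∀ a, η (f a) = f (θ a)) (r : ℕ)
    (x : WittVector p R) :
    wittDer η r (WittVector.map f x) = f (wittDer θ r x) := by
  simp [wittDer, map_coeff, h]

lemma wittDer_add_of_charZero {R : Type*} [CommRing R] [IsDomain R] [CharZero R]
    (θ : Derivation ℤ R R) (r : ℕ) (x y : WittVector p R) :
    wittDer θ r (x + y) = wittDer θ r x + wittDer θ r y := by
  cases r with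
  | zero => simp [wittDer]
  | succ r =>
    have hp : (p : R) ^ r ≠ 0 :=
      pow_ne_zero _ (Nat.cast_ne_zero.2 (Fact.out : p.Prime).ne_zero)
    refine mul_left_cancel₀ hp ?_
    rw [mul_add, ← derivation_ghostComponent, ← derivation_ghostComponent,
      ← derivation_ghostComponent, map_add, map_add]

/-- `F^{r-1} d` is additive. -/
lemma wittDer_add {R : Type*} [CommRing R] (θ : Derivation ℤ R R) (r : ℕ)
    (x y : WittVector p R) :
    wittDer θ r (x + y) = wittDer θ r x + wittDer θ r y := by
  let ev : MvPolynomial R ℤ →ₐ[ℤ] R := MvPolynomial.aeval id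
  let Θ : Derivation ℤ (MvPolynomial R ℤ) (MvPolynomial R ℤ) :=
    MvPolynomial.mkDerivation ℤ fun a => MvPolynomial.X (θ a)
  have hcomm : ∀ f, θ (ev f) = ev (Θ f) := by
    intro f
    induction f using MvPolynomial.induction_on with
    | C a => simp
    | add f g hf hg => simp [hf, hg]
    | mul_X f a hf => simp [hf, ev, Θ, MvPolynomial.mkDerivation_X]
  have hsurj : Function.Surjective (ev : MvPolynomial R ℤ →+* R) :=
    fun a => ⟨MvPolynomial.X a, by simp [ev]⟩
  obtain ⟨x', rfl⟩ := map_surjective (p := p) _ hsurj x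
  obtain ⟨y', rfl⟩ := map_surjective (p := p) _ hsurj y
  have key := wittDer_map (p := p) Θ θ (ev : MvPolynomial R ℤ →+* R) hcomm r
  rw [← map_add, key, key, key]
  exact (congrArg ev (wittDer_add_of_charZero Θ r x' y')).trans (map_add ev _ _)

lemma wittDer_sub {R : Type*} [CommRing R] (θ : Derivation ℤ R R) (r : ℕ)
    (x y : WittVector p R) :
    wittDer θ r (x - y) = wittDer θ r x - wittDer θ r y := by
  have := wittDer_add θ r (x - y) y
  rw [sub_add_cancel] at this
  rw [this, add_sub_cancel_right]

lemma derivation_pow_char {R : Type*} [CommRing R] [CharP R p] (θ : Derivation ℤ R R) (a : R) :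
    θ (a ^ p) = 0 := by
  simp [Derivation.leibniz_pow]

lemma wittDer_frobenius {R : Type*} [CommRing R] [CharP R p] (θ : Derivation ℤ R R) (r : ℕ)
    (x : WittVector p R) : wittDer θ r (frobenius x) = 0 := by
  refine Finset.sum_eq_zero fun i _ => ?_
  rw [coeff_frobenius_charP, derivation_pow_char, mul_zero]

lemma wittDer_sub_frobenius_sub {R : Type*} [CommRing R] [CharP R p] (θ : Derivation ℤ R R)
    (r : ℕ) (x g : WittVector p R) :
    wittDer θ r (x - (frobenius g - g)) = wittDer θ r x + wittDer θ r g := by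
  rw [wittDer_sub, wittDer_sub, wittDer_frobenius]
  ring

lemma wittDer_verschiebung {R : Type*} [CommRing R] (θ : Derivation ℤ R R) (r : ℕ)
    (x : WittVector p R) : wittDer θ (r + 1) (verschiebung x) = wittDer θ r x := by
  rw [wittDer, Finset.sum_range_succ', wittDer]
  simp only [verschiebung_coeff_zero, map_zero, mul_zero, add_zero]
  refine Finset.sum_congr rfl fun i hi => ?_
  have : r + 1 - 1 - (i + 1) = r - 1 - i := by omega
  rw [verschiebung_coeff_add_one, this]

end Witt

section Filtration

open WittVector

variable {p : ℕ} [Fact p.Prime] {L : Type*} [Field L] {v : AddValuation L (WithTop ℤ)}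

variable (v) in
/-- The filtration of Witt vectors of length `r` (given as the first `r` components of a Witt
vector) by pole order: `p ^ (r - 1 - i) * v (x_i) ≥ -μ` for all `i < r`. -/
def WittFil (r : ℕ) (μ : ℤ) (x : WittVector p L) : Prop :=
  ∀ i < r, ValGE v (-μ) (x.coeff i ^ p ^ (r - 1 - i))

lemma wittFil_iff [CharP L p] {τ : L} {r : ℕ} {μ : ℤ} (hτ : ValEq v μ τ)
    {x : WittVector p L} :
    WittFil v r μ x ↔
      ∀ i < r, (teichmuller p τ * frobenius^[r - 1] x).coeff i ∈ valSubring v := by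
  refine forall_congr' fun i => forall_congr' fun hi => ?_
  have e : r - 1 = (r - 1 - i) + i := by omega
  have h : (teichmuller p τ * frobenius^[r - 1] x).coeff i =
      (τ * x.coeff i ^ p ^ (r - 1 - i)) ^ p ^ i := by
    rw [teichmuller_mul_coeff_charP, iterate_frobenius_coeff, mul_pow, ← pow_mul, ← pow_add, ← e]
  have hpos : 0 < p ^ i := pow_pos (Fact.out : p.Prime).pos i
  rw [h, mem_valSubring]
  constructor
  · intro hx
    have := (hτ.ge.mul hx).pow (p ^ i)
    exact this.mono (by simp)
  · intro hx
    have h1 : ValGE v 0 (τ * x.coeff i ^ p ^ (r - 1 - i)) := ValGE.of_pow hpos (by simpa using hx)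
    have h2 := hτ.inv.ge.mul h1
    rw [inv_mul_cancel_left₀ hτ.ne_zero] at h2
    simpa using h2

lemma frobenius_iterate_sub {R : Type*} [CommRing R] (x y : WittVector p R) (j : ℕ) :
    frobenius^[j] (x - y) = frobenius^[j] x - frobenius^[j] y := by
  induction j generalizing x y with
  | zero => rfl
  | succ j ih => simp only [Function.iterate_succ_apply, map_sub, ih]

lemma WittFil.sub [CharP L p] {t : L} (ht : ValEq v 1 t) {r : ℕ} {μ : ℤ} {x y : WittVector p L}
    (hx : WittFil v r μ x) (hy : WittFil v r μ y) : WittFil v r μ (x - y) := by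
  have hτ : ValEq v μ (t ^ μ) := (ht.zpow μ).congr (mul_one μ)
  rw [wittFil_iff hτ] at hx hy ⊢
  rw [frobenius_iterate_sub, mul_sub]
  exact coeff_sub_mem_subring _ hx hy

lemma WittFil.zero {r : ℕ} {μ : ℤ} : WittFil v r μ (0 : WittVector p L) := by
  intro i _
  rw [zero_coeff, zero_pow (pow_pos (Fact.out : p.Prime).pos _).ne']
  exact ValGE.zero

lemma WittFil.add [CharP L p] {t : L} (ht : ValEq v 1 t) {r : ℕ} {μ : ℤ} {x y : WittVector p L}
    (hx : WittFil v r μ x) (hy : WittFil v r μ y) : WittFil v r μ (x + y) := by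
  have := hx.sub ht (WittFil.zero.sub ht hy)
  simpa using this

lemma WittFil.mono {r : ℕ} {μ μ' : ℤ} {x : WittVector p L} (hx : WittFil v r μ x)
    (h : μ ≤ μ') : WittFil v r μ' x :=
  fun i hi => (hx i hi).mono (neg_le_neg h)

lemma WittFil.verschiebung_iff {r : ℕ} {μ : ℤ} {x : WittVector p L} :
    WittFil v (r + 1) μ (verschiebung x) ↔ WittFil v r μ x := by
  have e : ∀ i, r + 1 - 1 - (i + 1) = r - 1 - i := fun i => by omega
  constructor
  · intro h i hi
    have := h (i + 1) (by omega)
    rwa [verschiebung_coeff_add_one, e] at this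
  · intro h i hi
    cases i with
    | zero =>
      rw [verschiebung_coeff_zero, zero_pow (pow_pos (Fact.out : p.Prime).pos _).ne']
      exact ValGE.zero
    | succ i =>
      rw [verschiebung_coeff_add_one, e]
      exact h i (by omega)

/-- If `F g` has poles bounded by `μ` then `g` has poles bounded by `μ / p`. -/
lemma WittFil.of_frobenius [CharP L p] {r : ℕ} {μ : ℤ} {x : WittVector p L}
    (h : WittFil v r μ (frobenius x)) : WittFil v r (μ / p) x := by
  intro i hi
  have h1 := h i hi
  rw [coeff_frobenius_charP, ← pow_mul, mul_comm p, pow_mul] at h1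
  have hp : (0 : ℤ) < p := by exact_mod_cast (Fact.out : p.Prime).pos
  by_cases hx : x.coeff i ^ p ^ (r - 1 - i) = 0
  · rw [hx]
    exact ValGE.zero
  obtain ⟨a, ha⟩ := ValEq.exists v hx
  refine ha.ge.mono ?_
  have := (ha.pow p).le h1
  have h2 : -a ≤ μ / p := (Int.le_ediv_iff_mul_le hp).2 (by linarith)
  linarith

end Filtration

section TotallyRamified

lemma eq_of_coprime_expansion {m : ℕ} {d c : ℤ} (hd : d ≠ 0) (hc : IsCoprime c m) {α β : ℤ}
    {i j : ℕ} (hi : i < m) (hj : j < m)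
    (h : m * d * α + i * (d * c) = m * d * β + j * (d * c)) : i = j := by
  have h1 : (m : ℤ) * α + i * c = m * β + j * c :=
    mul_left_cancel₀ hd (by linear_combination h)
  have h2 : (m : ℤ) ∣ (i - j : ℤ) * c := ⟨β - α, by linear_combination h1⟩
  have h3 : (m : ℤ) ∣ (i - j : ℤ) := hc.symm.dvd_of_dvd_mul_right h2
  have h4 := Int.eq_zero_of_abs_lt_dvd h3 (by rw [abs_lt]; constructor <;> omega)
  omega

variable {L : Type*} [Field L] {w : AddValuation L (WithTop ℤ)}

lemma val_ne_of_coprime_expansion {m : ℕ} {d c : ℤ} (hd : d ≠ 0) (hc : IsCoprime c m)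
    {z : L} (hz : ValEq w (d * c) z) {a : ℕ → L}
    (ha : ∀ i, a i ≠ 0 → ∃ α : ℤ, ValEq w (m * d * α) (a i)) :
    ∀ i ∈ Finset.range m, ∀ j ∈ Finset.range m, i ≠ j →
      a i * z ^ i ≠ 0 → a j * z ^ j ≠ 0 → w (a i * z ^ i) ≠ w (a j * z ^ j) := by
  intro i hi j hj hij hi0 hj0 h
  obtain ⟨α, hα⟩ := ha i (left_ne_zero_of_mul hi0)
  obtain ⟨β, hβ⟩ := ha j (left_ne_zero_of_mul hj0)
  have h1 : ValEq w (m * d * β + j * (d * c)) (a i * z ^ i) := h.trans (hβ.mul (hz.pow j))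
  exact hij (eq_of_coprime_expansion hd hc (Finset.mem_range.1 hi) (Finset.mem_range.1 hj)
    ((hα.mul (hz.pow i)).unique h1))

variable {K : Type*} [Field K] [Algebra K L] {N : ℕ}

lemma linearIndependent_pow_of_coprime {d c : ℤ} (hd : d ≠ 0) (hc : IsCoprime c N)
    {z : L} (hz : ValEq w (d * c) z)
    (hK : ∀ x : K, x ≠ 0 → ∃ a : ℤ, ValEq w (N * d * a) (algebraMap K L x)) :
    LinearIndependent K fun i : Fin N => z ^ (i : ℕ) := by
  rw [Fintype.linearIndependent_iff]
  intro g hg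
  by_contra! hne
  obtain ⟨i₀, hi₀⟩ := hne
  let a : ℕ → L := fun i => if h : i < N then algebraMap K L (g ⟨i, h⟩) else 0
  have ha : ∀ i, a i ≠ 0 → ∃ α : ℤ, ValEq w (N * d * α) (a i) := by
    intro i hi
    by_cases h : i < N
    · have hai : a i = algebraMap K L (g ⟨i, h⟩) := dif_pos h
      rw [hai] at hi ⊢
      exact hK _ (by simpa using hi)
    · exact absurd (dif_neg h) hi
  have hai : ∀ i : Fin N, a i = algebraMap K L (g i) := fun i => dif_pos i.2
  obtain ⟨j, _, b, _, _, hb⟩ := exists_dominant (val_ne_of_coprime_expansion hd hc hz ha)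
    ⟨i₀, Finset.mem_range.2 i₀.2, mul_ne_zero (by rw [hai]; simpa using hi₀)
      (pow_ne_zero _ hz.ne_zero)⟩
  refine hb.ne_zero ?_
  rw [← hg, Finset.sum_range]
  exact Finset.sum_congr rfl fun i _ => by rw [hai, Algebra.smul_def]

lemma exists_expansion [FiniteDimensional K L] (hN : Module.finrank K L = N)
    {z : L} (hz : ValEq w 1 z)
    (hK : ∀ x : K, x ≠ 0 → ∃ a : ℤ, ValEq w (N * a) (algebraMap K L x)) (x : L) :
    ∃ a : ℕ → K, x = ∑ i ∈ Finset.range N, algebraMap K L (a i) * z ^ i := by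
  have hli : LinearIndependent K fun i : Fin N => z ^ (i : ℕ) :=
    linearIndependent_pow_of_coprime (d := 1) (c := 1) one_ne_zero isCoprime_one_left
      (hz.congr (by simp)) fun x hx => by simpa using hK x hx
  have hspan := hli.span_eq_top_of_card_eq_finrank' (by rw [Fintype.card_fin, hN])
  have hx : x ∈ Submodule.span K (Set.range fun i : Fin N => z ^ (i : ℕ)) := by
    rw [hspan]; trivial
  obtain ⟨c, rfl⟩ := (Submodule.mem_span_range_iff_exists_fun K).1 hx
  refine ⟨fun i => if h : i < N then c ⟨i, h⟩ else 0, ?_⟩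
  rw [Finset.sum_range]
  refine Finset.sum_congr rfl fun i _ => ?_
  simp [Algebra.smul_def]

/-- The dominant term of an expansion in powers of a uniformizer. -/
lemma exists_dominant_expansion [FiniteDimensional K L] (hN : Module.finrank K L = N)
    {z : L} (hz : ValEq w 1 z)
    (hK : ∀ x : K, x ≠ 0 → ∃ a : ℤ, ValEq w (N * a) (algebraMap K L x)) {x : L} {b : ℤ}
    (hx : ValEq w b x) :
    ∃ a : ℕ → K, x = ∑ i ∈ Finset.range N, algebraMap K L (a i) * z ^ i ∧
      ∃ j ∈ Finset.range N, ∃ α : ℤ, ValEq w (N * α) (algebraMap K L (a j)) ∧ b = N * α + j ∧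
        ∀ i ∈ Finset.range N, i ≠ j → ValGE w (b + 1) (algebraMap K L (a i) * z ^ i) := by
  obtain ⟨a, rfl⟩ := exists_expansion hN hz hK x
  refine ⟨a, rfl, ?_⟩
  have h0 : ∃ i ∈ Finset.range N, algebraMap K L (a i) * z ^ i ≠ 0 := by
    by_contra! h
    exact hx.ne_zero (Finset.sum_eq_zero h)
  have ha : ∀ i, algebraMap K L (a i) ≠ 0 →
      ∃ α : ℤ, ValEq w (N * 1 * α) (algebraMap K L (a i)) := fun i hi => by
    simpa using hK (a i) (by simpa using hi)
  obtain ⟨j, hj, c, hc, hdom, hsum⟩ := exists_dominant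
    (val_ne_of_coprime_expansion (d := 1) (c := 1) one_ne_zero isCoprime_one_left
      (hz.congr (by simp)) ha) h0
  obtain ⟨α, hα⟩ := ha j (left_ne_zero_of_mul hc.ne_zero)
  have hcb : c = b := hsum.unique hx
  subst hcb
  refine ⟨j, hj, α, hα.congr (by ring), ?_, hdom⟩
  have := hc.unique (hα.mul (hz.pow j))
  rw [this]
  ring

lemma valEq_galois_uniformizer [FiniteDimensional K L] (hN : Module.finrank K L = N)
    {t : L} (ht : ValEq w 1 t)
    (hK : ∀ x : K, x ≠ 0 → ∃ a : ℤ, ValEq w (N * a) (algebraMap K L x)) (σ : L ≃ₐ[K] L) :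
    ValEq w 1 (σ t) := by
  have hN0 : 0 < N := hN ▸ Module.finrank_pos
  obtain ⟨a, hexp, j, hj, α, hα, hjα, hdom⟩ :=
    exists_dominant_expansion hN ht hK (ht.pow N)
  rw [Finset.mem_range] at hj
  have hj0 : j = 0 := by
    have : (N : ℤ) ∣ j := ⟨1 - α, by linarith⟩
    exact Nat.eq_zero_of_dvd_of_lt (by exact_mod_cast this) hj
  subst hj0
  have hα1 : α = 1 := by
    have : (N : ℤ) * (α - 1) = 0 := by push_cast at hjα; linarith
    rcases mul_eq_zero.1 this with h | h <;> omega
  subst hα1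
  have hge : ∀ i ∈ Finset.range N, ValGE w N (algebraMap K L (a i)) := by
    intro i hi
    by_cases h0 : a i = 0
    · rw [h0, map_zero]; exact ValGE.zero
    by_cases hi0 : i = 0
    · subst hi0; exact hα.ge.mono (by linarith)
    obtain ⟨β, hβ⟩ := hK _ h0
    have h1 := (hβ.mul (ht.pow i)).le (hdom i hi hi0)
    refine hβ.ge.mono ?_
    have hi' : (i : ℤ) < N := by exact_mod_cast Finset.mem_range.1 hi
    have : 0 < β := by
      by_contra! h
      have : (N : ℤ) * β ≤ 0 := mul_nonpos_of_nonneg_of_nonpos (by positivity) h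
      linarith
    nlinarith
  have hσ : σ t ^ N = ∑ i ∈ Finset.range N, algebraMap K L (a i) * σ t ^ i := by
    rw [← map_pow, hexp, map_sum]
    simp
  obtain ⟨c, hc⟩ := ValEq.exists w (x := σ t) (by simpa using ht.ne_zero)
  have hN1 : (1 : ℤ) ≤ N := by exact_mod_cast hN0
  rcases le_or_gt c 0 with h | h
  · exfalso
    have hsum : ValGE w (N * c + 1) (σ t ^ N) := by
      rw [hσ]
      refine ValGE.sum fun i hi => ((hge i hi).mul (hc.pow i).ge).mono ?_
      have hi' : (i : ℤ) + 1 ≤ N := by exact_mod_cast Finset.mem_range.1 hi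
      nlinarith
    linarith [(hc.pow N).le hsum]
  · have hsum : ValEq w N (σ t ^ N) := by
      rw [hσ]
      refine ValEq.sum_of_dominant (Finset.mem_range.2 hN0) ?_ ?_
      · simpa using hα
      · intro i hi hi0
        refine ((hge i hi).mul (hc.pow i).ge).mono ?_
        have : (1 : ℤ) ≤ i := by exact_mod_cast Nat.pos_of_ne_zero hi0
        nlinarith
    have := (hc.pow N).unique hsum
    exact hc.congr (by nlinarith)

lemma ValEq.galois [FiniteDimensional K L] (hN : Module.finrank K L = N)
    {t : L} (ht : ValEq w 1 t)
    (hK : ∀ x : K, x ≠ 0 → ∃ a : ℤ, ValEq w (N * a) (algebraMap K L x)) (σ : L ≃ₐ[K] L)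
    {x : L} {b : ℤ} (hx : ValEq w b x) : ValEq w b (σ x) := by
  have hσt := valEq_galois_uniformizer hN ht hK σ
  obtain ⟨a, rfl, j, hj, α, hα, rfl, hdom⟩ := exists_dominant_expansion hN ht hK hx
  have hterm : ∀ i, w (σ (algebraMap K L (a i) * t ^ i)) = w (algebraMap K L (a i) * t ^ i) := by
    intro i
    have h := (hσt.pow i).trans (ht.pow i).symm
    rw [map_mul, map_pow, AlgEquiv.commutes, AddValuation.map_mul, AddValuation.map_mul, h]
  rw [map_sum]
  refine ValEq.sum_of_dominant hj ((hterm j).trans ((hα.mul (ht.pow j)).congr (by ring))) ?_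
  intro i hi hij
  have := hdom i hi hij
  rwa [ValGE, ← hterm] at this

lemma ValGE.galois [FiniteDimensional K L] (hN : Module.finrank K L = N)
    {t : L} (ht : ValEq w 1 t)
    (hK : ∀ x : K, x ≠ 0 → ∃ a : ℤ, ValEq w (N * a) (algebraMap K L x)) (σ : L ≃ₐ[K] L)
    {x : L} {b : ℤ} (hx : ValGE w b x) : ValGE w b (σ x) := by
  by_cases h0 : x = 0
  · rw [h0, map_zero]; exact ValGE.zero
  obtain ⟨c, hc⟩ := ValEq.exists w h0
  exact (ValEq.galois hN ht hK σ hc).ge.mono (hc.le hx)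

/-- Every unit of `L` is congruent to an element of `K`: the residue fields agree. -/
lemma exists_residue [FiniteDimensional K L] (hN : Module.finrank K L = N)
    {t : L} (ht : ValEq w 1 t)
    (hK : ∀ x : K, x ≠ 0 → ∃ a : ℤ, ValEq w (N * a) (algebraMap K L x)) {x : L}
    (hx : ValEq w 0 x) :
    ∃ c : K, ValEq w 0 (algebraMap K L c) ∧ ValGE w 1 (x - algebraMap K L c) := by
  obtain ⟨a, hexp, j, hj, α, hα, hjα, hdom⟩ := exists_dominant_expansion hN ht hK hx
  have hj' := Finset.mem_range.1 hj
  have hj0 : j = 0 := by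
    have : (N : ℤ) ∣ j := ⟨-α, by linarith⟩
    exact Nat.eq_zero_of_dvd_of_lt (by exact_mod_cast this) hj'
  subst hj0
  refine ⟨a 0, hα.congr (by push_cast at hjα; linarith), ?_⟩
  rw [hexp, ← Finset.add_sum_erase _ _ hj, pow_zero, mul_one, add_sub_cancel_left]
  exact ValGE.sum fun i hi =>
    hdom i (Finset.mem_of_mem_erase hi) (Finset.ne_of_mem_erase hi)

/-- The automorphisms of `L` act trivially on the residue field and on `t` modulo `t ^ 2` as
soon as their order is a power of the residue characteristic. -/
lemma valGE_two_galois_sub {p n : ℕ} [Fact p.Prime] [CharP L p] [FiniteDimensional K L]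
    (hN : Module.finrank K L = N)
    {t : L} (ht : ValEq w 1 t)
    (hK : ∀ x : K, x ≠ 0 → ∃ a : ℤ, ValEq w (N * a) (algebraMap K L x)) {σ : L ≃ₐ[K] L}
    (hσ : σ ^ p ^ n = 1) : ValGE w 2 (σ t - t) := by
  have hσt := valEq_galois_uniformizer hN ht hK σ
  obtain ⟨c, hc, hσc⟩ := exists_residue hN ht hK ((hσt.div ht).congr (sub_self 1))
  have h1 : ValGE w 2 (σ t - algebraMap K L c * t) := by
    have := hσc.mul ht.ge
    rwa [sub_mul, div_mul_cancel₀ _ ht.ne_zero] at this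
  have hiter : ∀ m : ℕ, ValGE w 2 ((σ ^ m) t - algebraMap K L c ^ m * t) := by
    intro m
    induction m with
    | zero => simpa using ValGE.zero
    | succ m ih =>
      have e : (σ ^ (m + 1)) t - algebraMap K L c ^ (m + 1) * t =
          σ ((σ ^ m) t - algebraMap K L c ^ m * t) +
            algebraMap K L c ^ m * (σ t - algebraMap K L c * t) := by
        rw [pow_succ' σ, AlgEquiv.mul_apply, map_sub, map_mul, map_pow, AlgEquiv.commutes]
        ring
      rw [e]
      exact (ValGE.galois hN ht hK σ ih).add (((hc.pow m).ge.mul h1).mono (by simp))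
  have h2 := hiter (p ^ n)
  rw [hσ, AlgEquiv.one_apply] at h2
  have h3 : ValGE w 1 (algebraMap K L c - 1) := by
    have h4 := (h2.mul ht.inv.ge).neg
    have e : -((t - algebraMap K L c ^ p ^ n * t) * t⁻¹) = algebraMap K L c ^ p ^ n - 1 := by
      have := ht.ne_zero
      field_simp
      ring
    rw [e] at h4
    have h5 : ValGE w 1 (algebraMap K L c ^ p ^ n - 1) := h4.mono (by norm_num)
    have h7 : ValGE w 0 (algebraMap K L c - 1) := hc.ge.sub ValGE.one
    rcases h7.eq_or with h8 | h8
    · have := h8.pow (p ^ n)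
      rw [sub_pow_char_pow, one_pow, mul_zero] at this
      linarith [this.le h5]
    · simpa using h8
  have e : σ t - t = (σ t - algebraMap K L c * t) + (algebraMap K L c - 1) * t := by ring
  rw [e]
  exact h1.add (h3.mul ht.ge)

lemma exists_one_add_pow_sub_one {h : L} (hh : ValGE w 0 h) (j : ℕ) :
    ∃ r, ValGE w 0 r ∧ (1 + h) ^ j - 1 = h * (j + h * r) := by
  induction j with
  | zero => exact ⟨0, ValGE.zero, by simp⟩
  | succ j ih =>
    obtain ⟨r, hr, e⟩ := ih
    refine ⟨j + r + h * r, ?_, ?_⟩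
    · refine ValGE.add (ValGE.add ?_ hr) (by simpa using hh.mul hr)
      simpa using ValGE.intCast (v := w) (j : ℤ)
    · push_cast
      linear_combination (1 + h) * e

/-- How an automorphism `σ` moves an element of valuation `a`, in terms of `i = v (σ t - t)`. -/
lemma galois_sub_expansion {p : ℕ} [Fact p.Prime] [CharP L p] [FiniteDimensional K L]
    (hN : Module.finrank K L = N) (hpN : p ∣ N)
    {t : L} (ht : ValEq w 1 t)
    (hK : ∀ x : K, x ≠ 0 → ∃ a : ℤ, ValEq w (N * a) (algebraMap K L x)) {σ : L ≃ₐ[K] L}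
    {i : ℤ} (hi : 2 ≤ i) (hσ : ValEq w i (σ t - t)) {x : L} {b : ℤ} (hx : ValEq w b x) :
    ValGE w (b + i - 1) (σ x - x) ∧ (¬ (p : ℤ) ∣ b → ValEq w (b + i - 1) (σ x - x)) := by
  obtain ⟨a, rfl, j, hj, α, hα, rfl, hdom⟩ := exists_dominant_expansion hN ht hK hx
  set h : L := (σ t - t) / t with hdef
  have hh : ValEq w (i - 1) h := hσ.div ht
  have hσt : σ t = t * (1 + h) := by
    have := ht.ne_zero
    rw [hdef]
    field_simp
    ring
  have hterm : ∀ l, ∃ r, ValGE w 0 r ∧ σ (algebraMap K L (a l) * t ^ l) -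
      algebraMap K L (a l) * t ^ l = algebraMap K L (a l) * t ^ l * (h * (l + h * r)) := by
    intro l
    obtain ⟨r, hr, e⟩ := exists_one_add_pow_sub_one (hh.ge.mono (b := 0) (by linarith)) l
    refine ⟨r, hr, ?_⟩
    rw [← e, map_mul, map_pow, AlgEquiv.commutes, hσt, mul_pow]
    ring
  have hge : ∀ l, ∀ c : ℤ, ValGE w c (algebraMap K L (a l) * t ^ l) →
      ValGE w (c + i - 1) (σ (algebraMap K L (a l) * t ^ l) - algebraMap K L (a l) * t ^ l) := by
    intro l c hc
    obtain ⟨r, hr, e⟩ := hterm l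
    rw [e]
    have h1 : ValGE w 0 ((l : L) + h * r) := by
      refine ValGE.add ?_ ((hh.ge.mul hr).mono (by linarith))
      simpa using ValGE.intCast (v := w) (l : ℤ)
    exact (hc.mul (hh.ge.mul h1)).mono (by linarith)
  have htj : ValEq w (N * α + j) (algebraMap K L (a j) * t ^ j) :=
    (hα.mul (ht.pow j)).congr (by ring)
  rw [map_sum, ← Finset.sum_sub_distrib]
  constructor
  · refine ValGE.sum fun l hl => ?_
    by_cases hlj : l = j
    · subst hlj; exact hge l _ htj.ge
    · exact (hge l _ (hdom l hl hlj)).mono (by linarith)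
  · intro hpb
    refine ValEq.sum_of_dominant hj ?_ fun l hl hlj => (hge l _ (hdom l hl hlj)).mono (by linarith)
    obtain ⟨r, hr, e⟩ := hterm j
    rw [e]
    have hpj : ¬ (p : ℤ) ∣ (j : ℤ) := fun hd =>
      hpb (dvd_add (Dvd.dvd.mul_right (by exact_mod_cast hpN) α) hd)
    have h1 : ValEq w 0 ((j : L) + h * r) := by
      refine ValEq.add ?_ ((hh.ge.mul hr).mono (by linarith))
      simpa using ValEq.intCast (v := w) p hpj
    exact (htj.mul (hh.mul h1)).congr (by ring)

lemma valGE_one_galois_sub {p n : ℕ} [Fact p.Prime] [CharP L p] [FiniteDimensional K L]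
    (hN : Module.finrank K L = N) (hpN : p ∣ N)
    {t : L} (ht : ValEq w 1 t)
    (hK : ∀ x : K, x ≠ 0 → ∃ a : ℤ, ValEq w (N * a) (algebraMap K L x)) {σ : L ≃ₐ[K] L}
    (hσ : σ ^ p ^ n = 1) {x : L} (hx : ValGE w 0 x) : ValGE w 1 (σ x - x) := by
  by_cases hx0 : x = 0
  · rw [hx0, map_zero, sub_zero]; exact ValGE.zero
  obtain ⟨b, hb⟩ := ValEq.exists w hx0
  have h2 := valGE_two_galois_sub hN ht hK hσ
  by_cases hσt : σ t - t = 0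
  · obtain ⟨a, rfl⟩ := exists_expansion hN ht hK x
    rw [sub_eq_zero] at hσt
    rw [map_sum]
    simp only [map_mul, map_pow, AlgEquiv.commutes, hσt, sub_self]
    exact ValGE.zero
  obtain ⟨i, hi⟩ := ValEq.exists w hσt
  have := (galois_sub_expansion hN hpN ht hK (hi.le h2) hi hb).1
  exact this.mono (by linarith [hi.le h2, hb.le hx])

end TotallyRamified

section Derivation

/-- A derivation extends along a separable algebraic extension of fields. -/
lemma exists_derivation_extension {K L : Type*} [Field K] [Field L] [Algebra K L]
    [Algebra.IsSeparable K L] (D : Derivation ℤ K K) :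
    ∃ θ : Derivation ℤ L L, ∀ a : K, θ (algebraMap K L a) = algebraMap K L (D a) := by
  have := Algebra.FormallyEtale.of_isSeparable K L
  let D' : Derivation ℤ K L := (Algebra.linearMap K L).compDer D
  let φ := (D'.liftKaehlerDifferential.liftBaseChange L).comp
    (KaehlerDifferential.tensorKaehlerEquivOfFormallyEtale ℤ K L).symm.toLinearMap
  refine ⟨φ.compDer (KaehlerDifferential.D ℤ L), fun a => ?_⟩
  have h := KaehlerDifferential.tensorKaehlerEquivOfFormallyEtale_symm_D_algebraMap ℤ K L a
  show D'.liftKaehlerDifferential.liftBaseChange L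
    ((KaehlerDifferential.tensorKaehlerEquivOfFormallyEtale ℤ K L).symm
      (KaehlerDifferential.D ℤ L (algebraMap K L a))) = _
  rw [h, LinearMap.liftBaseChange_tmul, one_smul, Derivation.liftKaehlerDifferential_comp_D]
  rfl

variable {k : Type*} [Field k]

/-- The underlying function of the derivation `s d/ds` of `k((s))`. -/
noncomputable def laurentEuler (f : LaurentSeries k) : LaurentSeries k where
  coeff n := (n : k) * f.coeff n
  isPWO_support' := f.isPWO_support.mono fun n hn => by
    simp only [Function.mem_support] at hn
    exact right_ne_zero_of_mul hn

@[simp]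
lemma laurentEuler_coeff (f : LaurentSeries k) (n : ℤ) :
    (laurentEuler f).coeff n = (n : k) * f.coeff n := rfl

lemma laurentEuler_support (f : LaurentSeries k) : (laurentEuler f).support ⊆ f.support :=
  fun _ hn => right_ne_zero_of_mul hn

lemma laurentEuler_mul (f g : LaurentSeries k) :
    laurentEuler (f * g) = f * laurentEuler g + g * laurentEuler f := by
  rw [mul_comm g]
  ext n
  rw [laurentEuler_coeff, HahnSeries.coeff_add, HahnSeries.coeff_mul,
    HahnSeries.coeff_mul_left' f.isPWO_support (laurentEuler_support f),
    HahnSeries.coeff_mul_right' g.isPWO_support (laurentEuler_support g), Finset.mul_sum,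
    ← Finset.sum_add_distrib]
  refine Finset.sum_congr rfl fun ij hij => ?_
  have h : ij.1 + ij.2 = n := (Finset.mem_antidiagonal.1 hij).2.2
  rw [← h, laurentEuler_coeff, laurentEuler_coeff]
  push_cast
  ring

lemma laurentEuler_add (f g : LaurentSeries k) :
    laurentEuler (f + g) = laurentEuler f + laurentEuler g := by
  ext n
  rw [HahnSeries.coeff_add, laurentEuler_coeff, laurentEuler_coeff, laurentEuler_coeff,
    HahnSeries.coeff_add, mul_add]

/-- The derivation `s d/ds`, transported along an isomorphism with `k((s))`. -/
noncomputable def transportDerivation {K : Type*} [Field K] (ι : K ≃+* LaurentSeries k) :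
    Derivation ℤ K K :=
  Derivation.mk' (AddMonoidHom.mk' (fun x => ι.symm (laurentEuler (ι x))) fun x y => by
      rw [map_add, laurentEuler_add, map_add]).toIntLinearMap
    fun x y => by
      show ι.symm (laurentEuler (ι (x * y))) =
        x * ι.symm (laurentEuler (ι y)) + y * ι.symm (laurentEuler (ι x))
      rw [map_mul, laurentEuler_mul, map_add, map_mul, map_mul, ι.symm_apply_apply,
        ι.symm_apply_apply]

lemma transportDerivation_apply {K : Type*} [Field K] (ι : K ≃+* LaurentSeries k) (x : K) :
    ι (transportDerivation ι x) = laurentEuler (ι x) :=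
  ι.apply_symm_apply _

lemma laurentEuler_order (p : ℕ) [CharP k p] {f : LaurentSeries k}
    (h0 : laurentEuler f ≠ 0) :
    f.order ≤ (laurentEuler f).order ∧
      ((p : ℤ) ∣ f.order → f.order + 1 ≤ (laurentEuler f).order) := by
  have hne : (laurentEuler f).coeff (laurentEuler f).order ≠ 0 :=
    HahnSeries.coeff_order_eq_zero.not.2 h0
  rw [laurentEuler_coeff] at hne
  have h1 : f.order ≤ (laurentEuler f).order :=
    HahnSeries.order_le_of_coeff_ne_zero (right_ne_zero_of_mul hne)
  refine ⟨h1, fun hp => ?_⟩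
  rcases h1.eq_or_lt with h | h
  · refine absurd ?_ (left_ne_zero_of_mul hne)
    rw [← h]
    exact (CharP.intCast_eq_zero_iff k p _).2 hp
  · exact h

lemma laurentEuler_order_eq (p : ℕ) [CharP k p] {f : LaurentSeries k} (hf : f ≠ 0)
    (hp : ¬ (p : ℤ) ∣ f.order) :
    laurentEuler f ≠ 0 ∧ (laurentEuler f).order = f.order := by
  have h : (laurentEuler f).coeff f.order ≠ 0 := by
    rw [laurentEuler_coeff]
    refine mul_ne_zero ?_ (HahnSeries.coeff_order_eq_zero.not.2 hf)
    rwa [Ne, CharP.intCast_eq_zero_iff k p]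
  have h0 : laurentEuler f ≠ 0 := by
    intro h'
    rw [h'] at h
    simp at h
  exact ⟨h0, le_antisymm (HahnSeries.order_le_of_coeff_ne_zero h) (laurentEuler_order p h0).1⟩

/-- A unit of `k[[s]]` is congruent to a `p`-th power when `k` is perfect. -/
lemma exists_residue_pow (p : ℕ) [Fact p.Prime] [CharP k p] [PerfectField k]
    {f : LaurentSeries k} (hf : f ≠ 0) (h0 : f.order = 0) :
    ∃ g : LaurentSeries k, g ≠ 0 ∧ g.order = 0 ∧ (f - g ^ p ≠ 0 → 1 ≤ (f - g ^ p).order) := by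
  have : ExpChar k p := ExpChar.prime Fact.out
  obtain ⟨c, hc⟩ := (PerfectField.toPerfectRing p (K := k)).bijective_frobenius.2 (f.coeff 0)
  have hf0 : f.coeff 0 ≠ 0 := by
    have := HahnSeries.coeff_order_eq_zero.not.2 hf
    rwa [h0] at this
  have hc0 : c ≠ 0 := by
    rintro rfl
    exact hf0 (hc.symm.trans (zero_pow (Fact.out : p.Prime).ne_zero))
  refine ⟨HahnSeries.C c, ?_, ?_, fun hne => ?_⟩
  · simpa using hc0
  · exact HahnSeries.order_C
  · have hcp : HahnSeries.C c ^ p = (HahnSeries.C (f.coeff 0) : LaurentSeries k) := by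
      rw [← map_pow, ← hc]
    rw [hcp] at hne ⊢
    have hne' := HahnSeries.coeff_order_eq_zero.not.2 hne
    by_contra! hlt
    have h2 : (f - HahnSeries.C (f.coeff 0)).order ≤ 0 := by omega
    refine hne' ?_
    rw [HahnSeries.coeff_sub]
    rcases h2.eq_or_lt with h | h
    · rw [h]
      simp
    · have h3 : (HahnSeries.C (f.coeff 0)).coeff
          (f - HahnSeries.C (f.coeff 0) : LaurentSeries k).order = 0 :=
        HahnSeries.coeff_single_of_ne h.ne
      rw [h3, HahnSeries.coeff_eq_zero_of_lt_order (by rwa [h0]), sub_zero]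

end Derivation

section Level

open WittVector

variable {p : ℕ} [Fact p.Prime] {L : Type*} [Field L] {w : AddValuation L (WithTop ℤ)}
  {θ : Derivation ℤ L L} {E : Subfield L} {q C : ℤ}

variable (p w θ E q C) in
/-- A subfield `E` of `L` over which `L` is totally ramified of ramification index `q`, together
with the behaviour of the derivation `θ` on `E`: it shifts valuations by exactly `-C`, apart from
the elements whose normalized valuation is divisible by `p`. -/
structure RamificationLevel : Prop where
  index_pos : 0 < q
  val : ∀ x ∈ E, x ≠ 0 → ∃ a : ℤ, ValEq w (q * a) x
  unif : ∃ π ∈ E, ValEq w q π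
  res : ∀ x, ValEq w 0 x → ∃ b ∈ E, ValEq w 0 b ∧ ValGE w 1 (x - b ^ p)
  der : ∀ x ∈ E, ∀ a : ℤ, ValEq w (q * a) x → ValGE w (q * a - C) (θ x) ∧
    (¬ (p : ℤ) ∣ a → ValEq w (q * a - C) (θ x)) ∧
    ((p : ℤ) ∣ a → ValGE w (q * a - C + 1) (θ x))

namespace RamificationLevel

lemma exists_pow_approx (h : RamificationLevel p w θ E q C) {x : L} {a : ℤ}
    (hx : ValEq w (q * (p * a)) x) :
    ∃ g ∈ E, ValEq w (q * a) g ∧ ValGE w (q * (p * a) + 1) (x - g ^ p) := by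
  obtain ⟨π, hπE, hπ⟩ := h.unif
  have hz := hπ.zpow a
  have hzp := hz.pow p
  obtain ⟨b, hbE, hb, hxb⟩ := h.res _ ((hx.div hzp).congr (by ring))
  refine ⟨b * π ^ a, mul_mem hbE (zpow_mem hπE a), (hb.mul hz).congr (by ring), ?_⟩
  have := hxb.mul hzp.ge
  rw [sub_mul, div_mul_cancel₀ _ hzp.ne_zero, ← mul_pow] at this
  exact this.mono (by linarith)

lemma pow_mul_der (h : RamificationLevel p w θ E q C) {x : L} (hxE : x ∈ E) {a : ℤ}
    (hx : ValEq w (q * a) x) {P : ℕ} (hP : 0 < P) :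
    ValGE w (P * (q * a) - C) (x ^ (P - 1) * θ x) ∧
    (¬ (p : ℤ) ∣ a → ValEq w (P * (q * a) - C) (x ^ (P - 1) * θ x)) ∧
    ((p : ℤ) ∣ a → ValGE w (P * (q * a) - C + 1) (x ^ (P - 1) * θ x)) := by
  obtain ⟨P, rfl⟩ := Nat.exists_eq_succ_of_ne_zero hP.ne'
  obtain ⟨h1, h2, h3⟩ := h.der x hxE a hx
  simp only [Nat.succ_eq_add_one, Nat.add_sub_cancel, Nat.cast_add, Nat.cast_one]
  exact ⟨((hx.pow P).ge.mul h1).mono (by linarith),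
    fun hp => ((hx.pow P).mul (h2 hp)).congr (by ring),
    fun hp => ((hx.pow P).ge.mul (h3 hp)).mono (by linarith)⟩

lemma valGE_wittDer (h : RamificationLevel p w θ E q C) {r : ℕ} {μ : ℤ} {g : WittVector p L}
    (hg : g ∈ wittSubring p E.toSubring) (hfil : WittFil w r μ g) :
    ValGE w (-μ - C) (wittDer θ r g) := by
  refine ValGE.sum fun i hi => ?_
  have hiE : g.coeff i ∈ E := mem_wittSubring.1 hg i
  by_cases h0 : g.coeff i = 0
  · rw [h0, map_zero, mul_zero]; exact ValGE.zero
  obtain ⟨a, ha⟩ := h.val _ hiE h0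
  have hP : 0 < p ^ (r - 1 - i) := pow_pos (Fact.out : p.Prime).pos _
  refine (h.pow_mul_der hiE ha hP).1.mono ?_
  have := (ha.pow (p ^ (r - 1 - i))).le (hfil i (Finset.mem_range.1 hi))
  linarith

/-- If `x` has poles bounded by `μ` and its differential has a smaller pole than this bound
permits, then each component attaining the bound has normalized valuation divisible by `p`. -/
lemma dvd_of_critical (h : RamificationLevel p w θ E q C) {r : ℕ} {μ : ℤ} {x : WittVector p L}
    (hx : x ∈ wittSubring p E.toSubring) (hfil : WittFil w r μ x)
    (hder : ValGE w (-μ - C + 1) (wittDer θ r x)) {j : ℕ} (hj : j < r) {a : ℤ}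
    (ha : ValEq w (q * a) (x.coeff j))
    (hcrit : ((p ^ (r - 1 - j) : ℕ) : ℤ) * (q * a) = -μ) : (p : ℤ) ∣ a := by
  by_contra hpa
  have hpp : (p : ℤ) ≠ 0 := by exact_mod_cast (Fact.out : p.Prime).ne_zero
  have hP : ∀ k, 0 < p ^ k := fun k => pow_pos (Fact.out : p.Prime).pos k
  have hE : ∀ i, x.coeff i ∈ E := fun i => mem_wittSubring.1 hx i
  have hsum : ValEq w (-μ - C) (wittDer θ r x) := by
    refine ValEq.sum_of_dominant (Finset.mem_range.2 hj) ?_ fun i hi hij => ?_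
    · exact ((h.pow_mul_der (hE j) ha (hP _)).2.1 hpa).congr (by rw [hcrit])
    · rw [Finset.mem_range] at hi
      by_cases h0 : x.coeff i = 0
      · rw [h0, map_zero, mul_zero]; exact ValGE.zero
      obtain ⟨b, hb⟩ := h.val _ (hE i) h0
      have hle := (hb.pow (p ^ (r - 1 - i))).le (hfil i hi)
      obtain ⟨h1, -, h3⟩ := h.pow_mul_der (hE i) hb (hP (r - 1 - i))
      rcases hle.eq_or_lt with heq | hlt
      · refine (h3 ?_).mono (by rw [← heq])
        by_contra hpb
        have e : (p : ℤ) ^ (r - 1 - i) * b = (p : ℤ) ^ (r - 1 - j) * a := by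
          refine mul_left_cancel₀ h.index_pos.ne' ?_
          push_cast at heq hcrit
          linear_combination -heq + -1 * hcrit
        rcases lt_trichotomy (r - 1 - i) (r - 1 - j) with hlt | heq' | hlt
        · obtain ⟨c, hc⟩ := Nat.exists_eq_add_of_lt hlt
          rw [hc, add_assoc, pow_add, mul_assoc] at e
          have := mul_left_cancel₀ (pow_ne_zero _ hpp) e
          exact hpb ⟨(p : ℤ) ^ c * a, by rw [this]; ring⟩
        · omega
        · obtain ⟨c, hc⟩ := Nat.exists_eq_add_of_lt hlt
          rw [hc, add_assoc, pow_add, mul_assoc] at e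
          have := mul_left_cancel₀ (pow_ne_zero _ hpp) e
          exact hpa ⟨(p : ℤ) ^ c * b, by rw [← this]; ring⟩
      · exact h1.mono (by linarith)
  linarith [hsum.le hder]

/-- One Artin–Schreier–Witt modification lowering the pole of the `j`-th component. -/
lemma exists_modification [CharP L p] (h : RamificationLevel p w θ E q C) {t : L}
    (ht : ValEq w 1 t) {r : ℕ} {μ : ℤ}
    (hμ : 0 ≤ μ) {x : WittVector p L} (hfil : WittFil w r μ x) {j : ℕ} (hj : j < r) {a : ℤ}
    (ha0 : a < 0) (ha : ValEq w (q * (p * a)) (x.coeff j)) :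
    ∃ g ∈ wittSubring p E.toSubring, WittFil w r (μ / p) g ∧
      WittFil w r μ (x - (frobenius g - g)) ∧
      (∀ i < j, (x - (frobenius g - g)).coeff i = x.coeff i) ∧
      ValGE w (q * (p * a) + 1) ((x - (frobenius g - g)).coeff j) := by
  have hp1 : (1 : ℤ) < p := by exact_mod_cast (Fact.out : p.Prime).one_lt
  obtain ⟨b, hbE, hb, hxb⟩ := h.exists_pow_approx ha
  set g : WittVector p L := verschiebung^[j] (teichmuller p b) with hg
  have hFg : frobenius g = verschiebung^[j] (teichmuller p (b ^ p)) := by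
    have hc : Function.Commute (frobenius : WittVector p L → _) verschiebung :=
      fun z => (verschiebung_frobenius_comm z).symm
    rw [hg, (hc.iterate_right j).eq, frobenius_teichmuller_charP]
  have hsplit : x - (frobenius g - g) =
      x + verschiebung^[j] (teichmuller p b - teichmuller p (b ^ p)) := by
    rw [hFg, iterate_map_sub]
    ring
  have hFfil : WittFil w r μ (frobenius g) := by
    intro i hi
    have hP : p ^ (r - 1 - i) ≠ 0 := (pow_pos (Fact.out : p.Prime).pos _).ne'
    rw [hFg]
    rcases lt_trichotomy i j with hij | rfl | hij
    · rw [iterate_verschiebung_coeff_eq_zero _ hij, zero_pow hP]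
      exact ValGE.zero
    · have := iterate_verschiebung_coeff (teichmuller p (b ^ p)) i 0
      rw [zero_add, teichmuller_coeff_zero] at this
      rw [this]
      have h1 := (hb.pow p).pow (p ^ (r - 1 - i))
      have h2 := (ha.pow (p ^ (r - 1 - i))).le (hfil i hi)
      exact h1.ge.mono (by linarith)
    · obtain ⟨c, rfl⟩ := Nat.exists_eq_add_of_lt hij
      have := iterate_verschiebung_coeff (teichmuller p (b ^ p)) j (c + 1)
      rw [teichmuller_coeff_pos _ _ _ (Nat.succ_pos c)] at this
      rw [show j + c + 1 = c + 1 + j by ring, this,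
        zero_pow (pow_ne_zero _ (Fact.out : p.Prime).ne_zero)]
      exact ValGE.zero
  have hgfil := hFfil.of_frobenius
  have hle : μ / p ≤ μ := Int.ediv_le_self _ hμ
  refine ⟨g, ?_, hgfil, hfil.sub ht (hFfil.sub ht (hgfil.mono hle)), fun i hi => ?_, ?_⟩
  · have : ∀ j, verschiebung^[j] (teichmuller p b) ∈ wittSubring p E.toSubring := by
      intro j
      induction j with
      | zero => exact teichmuller_mem_wittSubring hbE
      | succ j ih =>
        rw [Function.iterate_succ_apply']
        exact verschiebung_mem_wittSubring ih
    exact this j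
  · rw [hsplit, coeff_add_verschiebung_iterate_of_lt _ _ hi]
  · have h0 : (teichmuller p b - teichmuller p (b ^ p)).coeff 0 = b - b ^ p := by
      have := map_sub constantCoeff (teichmuller p b) (teichmuller p (b ^ p))
      simpa only [constantCoeff_apply, teichmuller_coeff_zero] using this
    rw [hsplit, coeff_add_verschiebung_iterate_self, h0]
    have e : x.coeff j + (b - b ^ p) = (x.coeff j - b ^ p) + b := by ring
    rw [e]
    refine hxb.add (hb.ge.mono ?_)
    have : q * (p * a) < q * a := mul_lt_mul_of_pos_left (by nlinarith) h.index_pos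
    linarith

lemma sub_frobenius_sub_trans {R : Type*} [CommRing R] (x g g' : WittVector p R) :
    x - (frobenius g - g) - (frobenius g' - g') = x - (frobenius (g + g') - (g + g')) := by
  rw [map_add]
  ring

lemma sub_frobenius_sub_mem [CharP L p] {R : Subring L} {x g : WittVector p L}
    (hx : x ∈ wittSubring p R) (hg : g ∈ wittSubring p R) :
    x - (frobenius g - g) ∈ wittSubring p R :=
  sub_mem hx (sub_mem (frobenius_mem_wittSubring hg) hg)

/-- Modify `x` so as to make its first component have a pole of order prime to `p`. -/
lemma exists_normalization [CharP L p] (h : RamificationLevel p w θ E q C) {t : L}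
    (ht : ValEq w 1 t) {r : ℕ} (hr : 0 < r) {μ : ℤ}
    (hμ : 0 < μ) {x : WittVector p L} (hx : x ∈ wittSubring p E.toSubring)
    (hfil : WittFil w r μ x) (hder : ValEq w (-μ - C) (wittDer θ r x))
    (hneg : ∀ g ∈ wittSubring p E.toSubring, ¬ ValGE w 0 ((x - (frobenius g - g)).coeff 0)) :
    ∃ g ∈ wittSubring p E.toSubring, WittFil w r μ (x - (frobenius g - g)) ∧
      ValEq w (-μ - C) (wittDer θ r (x - (frobenius g - g))) ∧
      ∃ a : ℤ, 0 < a ∧ ¬ (p : ℤ) ∣ a ∧ ValEq w (-(q * a)) ((x - (frobenius g - g)).coeff 0) := by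
  have hp1 : (1 : ℤ) < p := by exact_mod_cast (Fact.out : p.Prime).one_lt
  have h00 := hneg 0 (zero_mem _)
  rw [map_zero, sub_zero, sub_zero] at h00
  have h0 : x.coeff 0 ≠ 0 := fun hc => h00 (by rw [hc]; exact ValGE.zero)
  obtain ⟨a, ha⟩ := h.val _ (mem_wittSubring.1 hx 0) h0
  have ha0 : a < 0 := by
    by_contra! hc
    exact h00 (ha.ge.mono (mul_nonneg h.index_pos.le hc))
  by_cases hpa : (p : ℤ) ∣ a
  · obtain ⟨b, rfl⟩ := hpa
    have hb0 : b < 0 := by nlinarith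
    obtain ⟨g, hg, hgfil, hfil', -, hval⟩ := h.exists_modification ht hμ.le hfil hr hb0 ha
    have hx' := sub_frobenius_sub_mem hx hg
    have hder' : ValEq w (-μ - C) (wittDer θ r (x - (frobenius g - g))) := by
      rw [wittDer_sub_frobenius_sub]
      refine hder.add ((h.valGE_wittDer hg hgfil).mono ?_)
      have : μ / p < μ := Int.ediv_lt_self_of_pos_of_ne_one hμ hp1.ne'
      linarith
    obtain ⟨g', hg', h1, h2, h3⟩ := exists_normalization h ht hr hμ hx' hfil' hder'
      fun g' hg' => by
        rw [sub_frobenius_sub_trans]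
        exact hneg _ (add_mem hg hg')
    refine ⟨g + g', add_mem hg hg', ?_⟩
    rw [← sub_frobenius_sub_trans]
    exact ⟨h1, h2, h3⟩
  · refine ⟨0, zero_mem _, ?_⟩
    rw [map_zero, sub_zero, sub_zero]
    exact ⟨hfil, hder, -a, by linarith, by rwa [dvd_neg], ha.congr (by ring)⟩
termination_by (-(w (x.coeff 0)).untopD 0).toNat
decreasing_by
  obtain ⟨c, hc⟩ := ValEq.exists w (x := (x - (frobenius g - g)).coeff 0) fun hc => by
    have := hneg g hg
    rw [hc] at this
    exact this ValGE.zero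
  have h1 : c < 0 := by
    by_contra! hc'
    exact hneg g hg (hc.ge.mono hc')
  have h2 := hc.le hval
  rw [hc, ha, WithTop.untopD_coe, WithTop.untopD_coe]
  omega

/-- If `x` has poles bounded by `μ` and its differential has a smaller pole than this bound
permits, then the poles of `x` can be lowered by an Artin–Schreier–Witt modification. -/
lemma exists_reduction_step [CharP L p] (h : RamificationLevel p w θ E q C) {t : L}
    (ht : ValEq w 1 t) {r : ℕ} {μ : ℤ}
    (hμ : 0 < μ) (hqμ : q ∣ μ) {x : WittVector p L} (hx : x ∈ wittSubring p E.toSubring)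
    (hfil : WittFil w r μ x) (hder : ValGE w (-μ - C + 1) (wittDer θ r x)) :
    ∃ g ∈ wittSubring p E.toSubring, WittFil w r (μ / p) g ∧
      WittFil w r (μ - q) (x - (frobenius g - g)) := by
  have hp1 : (1 : ℤ) < p := by exact_mod_cast (Fact.out : p.Prime).one_lt
  have hμp : μ / p < μ := Int.ediv_lt_self_of_pos_of_ne_one hμ hp1.ne'
  have hP : ∀ k, 0 < p ^ k := fun k => pow_pos (Fact.out : p.Prime).pos k
  have key : ∀ j ≤ r, ∃ g ∈ wittSubring p E.toSubring, WittFil w r (μ / p) g ∧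
      WittFil w r μ (x - (frobenius g - g)) ∧
      ∀ i < j, ValGE w (-μ + 1) ((x - (frobenius g - g)).coeff i ^ p ^ (r - 1 - i)) := by
    intro j
    induction j with
    | zero =>
      intro _
      refine ⟨0, zero_mem _, WittFil.zero, ?_, fun i hi => absurd hi (Nat.not_lt_zero i)⟩
      rwa [map_zero, sub_zero, sub_zero]
    | succ j ih =>
      intro hj
      obtain ⟨g, hg, hgfil, hfil', hlow⟩ := ih (by omega)
      have hj' : j < r := hj
      rcases (hfil' j hj').eq_or with hc | hc
      · have hx' := sub_frobenius_sub_mem hx hg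
        have hne : (x - (frobenius g - g)).coeff j ≠ 0 := fun h0 =>
          hc.ne_zero (by rw [h0, zero_pow (hP _).ne'])
        obtain ⟨a, ha⟩ := h.val _ (mem_wittSubring.1 hx' j) hne
        have hcrit := (ha.pow (p ^ (r - 1 - j))).unique hc
        have hder' : ValGE w (-μ - C + 1) (wittDer θ r (x - (frobenius g - g))) := by
          rw [wittDer_sub_frobenius_sub]
          exact hder.add ((h.valGE_wittDer hg hgfil).mono (by linarith))
        obtain ⟨b, rfl⟩ := h.dvd_of_critical hx' hfil' hder' hj' ha hcrit
        have hb0 : b < 0 := by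
          by_contra! hb
          have h1 : 0 ≤ ((p ^ (r - 1 - j) : ℕ) : ℤ) * (q * (p * b)) :=
            mul_nonneg (by positivity)
              (mul_nonneg h.index_pos.le (mul_nonneg (by linarith) hb))
          linarith
        obtain ⟨g', hg', hgfil', hfil'', heq, hval⟩ :=
          h.exists_modification ht hμ.le hfil' hj' hb0 ha
        refine ⟨g + g', add_mem hg hg', hgfil.add ht hgfil', ?_⟩
        rw [← sub_frobenius_sub_trans]
        refine ⟨hfil'', fun i hi => ?_⟩
        rcases Nat.lt_succ_iff_lt_or_eq.1 hi with hij | rfl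
        · rw [heq i hij]
          exact hlow i hij
        · refine (hval.pow (p ^ (r - 1 - i))).mono ?_
          have : (1 : ℤ) ≤ ((p ^ (r - 1 - i) : ℕ) : ℤ) := by exact_mod_cast hP _
          rw [mul_add, hcrit]
          linarith
      · refine ⟨g, hg, hgfil, hfil', fun i hi => ?_⟩
        rcases Nat.lt_succ_iff_lt_or_eq.1 hi with hij | rfl
        · exact hlow i hij
        · exact hc
  obtain ⟨g, hg, hgfil, -, hlow⟩ := key r le_rfl
  refine ⟨g, hg, hgfil, fun i hi => ?_⟩
  have hx' := sub_frobenius_sub_mem hx hg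
  by_cases h0 : (x - (frobenius g - g)).coeff i = 0
  · rw [h0, zero_pow (hP _).ne']; exact ValGE.zero
  obtain ⟨a, ha⟩ := h.val _ (mem_wittSubring.1 hx' i) h0
  have hap := ha.pow (p ^ (r - 1 - i))
  refine hap.ge.mono ?_
  have h1 := hap.le (hlow i hi)
  obtain ⟨m, rfl⟩ := hqμ
  have h2 : q * (-m) < q * (((p ^ (r - 1 - i) : ℕ) : ℤ) * a) := by linarith
  have h3 := lt_of_mul_lt_mul_left h2 h.index_pos.le
  have h4 : q * (-m + 1) ≤ q * (((p ^ (r - 1 - i) : ℕ) : ℤ) * a) :=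
    mul_le_mul_of_nonneg_left (by linarith) h.index_pos.le
  linarith

lemma exists_reduction [CharP L p] (h : RamificationLevel p w θ E q C) {t : L}
    (ht : ValEq w 1 t) {r : ℕ} {μ₀ μ : ℤ}
    (hμ : 0 < μ) (hle : μ ≤ μ₀) (hlt : μ₀ < p * μ) (hq₀ : q ∣ μ₀) (hq : q ∣ μ)
    {x : WittVector p L} (hx : x ∈ wittSubring p E.toSubring)
    (hfil : WittFil w r μ₀ x) (hder : ValEq w (-μ - C) (wittDer θ r x)) :
    ∃ g ∈ wittSubring p E.toSubring, WittFil w r μ (x - (frobenius g - g)) ∧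
      ValEq w (-μ - C) (wittDer θ r (x - (frobenius g - g))) := by
  have hp0 : (0 : ℤ) < p := by exact_mod_cast (Fact.out : p.Prime).pos
  rcases hle.eq_or_lt with rfl | hlt'
  · refine ⟨0, zero_mem _, ?_⟩
    rw [map_zero, sub_zero, sub_zero]
    exact ⟨hfil, hder⟩
  obtain ⟨g, hg, hgfil, hfil'⟩ := h.exists_reduction_step ht (hμ.trans hlt') hq₀ hx hfil
    (hder.ge.mono (by linarith))
  have hder' : ValEq w (-μ - C) (wittDer θ r (x - (frobenius g - g))) := by
    rw [wittDer_sub_frobenius_sub]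
    refine hder.add ((h.valGE_wittDer hg hgfil).mono ?_)
    have : μ₀ / p < μ := Int.ediv_lt_of_lt_mul hp0 (by linarith)
    linarith
  have hstep : μ ≤ μ₀ - q := by
    obtain ⟨m, rfl⟩ := hq
    obtain ⟨m₀, rfl⟩ := hq₀
    have h1 : m < m₀ := lt_of_mul_lt_mul_left hlt' h.index_pos.le
    have h2 : q * m ≤ q * (m₀ - 1) :=
      mul_le_mul_of_nonneg_left (by linarith) h.index_pos.le
    linarith
  have hq1 := h.index_pos
  obtain ⟨g', hg', h1, h2⟩ := exists_reduction h ht hμ hstep (by linarith)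
    (dvd_sub_self_right.2 hq₀) hq (sub_frobenius_sub_mem hx hg) hfil' hder'
  refine ⟨g + g', add_mem hg hg', ?_⟩
  rw [← sub_frobenius_sub_trans]
  exact ⟨h1, h2⟩
termination_by (μ₀ - μ).toNat
decreasing_by
  omega

end RamificationLevel

end Level

section Tower

open WittVector

variable {p : ℕ} [hp : Fact p.Prime] {L : Type*} [Field L]

lemma exists_artinSchreier_subfield (E : Subfield L) {z : L} (hz : z ^ p - z ∈ E) :
    ∃ E' : Subfield L, E ≤ E' ∧ z ∈ E' ∧
      ∀ x ∈ E', ∃ a : ℕ → L, (∀ i, a i ∈ E) ∧ x = ∑ i ∈ Finset.range p, a i * z ^ i := by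
  let g : Polynomial E := Polynomial.X ^ p + -(Polynomial.X + Polynomial.C ⟨_, hz⟩)
  have hdeg : (-(Polynomial.X + Polynomial.C (⟨_, hz⟩ : E))).degree < (p : WithBot ℕ) := by
    rw [Polynomial.degree_neg, Polynomial.degree_X_add_C]
    exact_mod_cast hp.out.one_lt
  have hmonic : g.Monic := Polynomial.monic_X_pow_add hdeg
  have hnat : g.natDegree = p :=
    Polynomial.natDegree_eq_of_degree_eq_some (by
      rw [Polynomial.degree_add_eq_left_of_degree_lt, Polynomial.degree_X_pow]
      rwa [Polynomial.degree_X_pow])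
  have hroot : Polynomial.aeval z g = 0 := by
    simp only [g, map_neg, map_pow, map_add, Polynomial.aeval_X, Polynomial.aeval_C]
    show z ^ p + -(z + (z ^ p - z)) = 0
    ring
  have hint : IsIntegral E z := ⟨g, hmonic, by rwa [Polynomial.aeval_def] at hroot⟩
  let F : IntermediateField E L := IntermediateField.adjoin E {z}
  have hEF : ∀ x ∈ E, x ∈ F.toSubfield := fun x hx => F.algebraMap_mem ⟨x, hx⟩
  refine ⟨F.toSubfield, hEF, ?_, ?_⟩
  · exact IntermediateField.mem_adjoin_simple_self E z
  · intro x hx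
    have hx' : x ∈ (IntermediateField.adjoin E {z}).toSubalgebra := hx
    rw [IntermediateField.adjoin_simple_toSubalgebra_of_isAlgebraic hint.isAlgebraic,
      Algebra.adjoin_singleton_eq_range_aeval] at hx'
    obtain ⟨f, rfl⟩ := hx'
    have hlt : (f %ₘ g).natDegree < p := by
      rw [← hnat]
      exact Polynomial.natDegree_modByMonic_lt f hmonic fun h => by
        rw [h, Polynomial.natDegree_one] at hnat
        exact hp.out.ne_zero hnat.symm
    refine ⟨fun i => ((f %ₘ g).coeff i : L), fun i => ((f %ₘ g).coeff i).2, ?_⟩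
    show Polynomial.aeval z f = _
    rw [← Polynomial.aeval_modByMonic_eq_self_of_root hroot,
      Polynomial.aeval_eq_sum_range' hlt]
    exact Finset.sum_congr rfl fun i _ => by rw [Algebra.smul_def]; rfl

variable {w : AddValuation L (WithTop ℤ)} {θ : Derivation ℤ L L} {E : Subfield L} {q C : ℤ}

/-- The valuation of a root of an Artin–Schreier equation with a pole. -/
lemma ValEq.artinSchreier_root {z : L} {a : ℤ} (ha : 0 < a)
    (hz : ValEq w (-(p * a)) (z ^ p - z)) : ValEq w (-a) z := by
  have hp1 : (1 : ℤ) < p := by exact_mod_cast hp.out.one_lt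
  have hz0 : z ≠ 0 := by
    rintro rfl
    rw [zero_pow hp.out.ne_zero, sub_zero] at hz
    exact hz.ne_zero rfl
  obtain ⟨c, hc⟩ := ValEq.exists w hz0
  have hc0 : c < 0 := by
    by_contra! h
    have := hz.le (((hc.pow p).ge.mono (b := 0) (by positivity)).sub (hc.ge.mono h))
    nlinarith
  have h1 := ((hc.pow p).sub (hc.ge.mono (by nlinarith))).unique hz
  exact hc.congr (by nlinarith)

lemma valGE_artinSchreier_root {z : L} (hz : ValGE w 0 (z ^ p - z)) : ValGE w 0 z := by
  by_cases hz0 : z = 0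
  · exact hz0 ▸ ValGE.zero
  have hp1 : (1 : ℤ) < p := by exact_mod_cast hp.out.one_lt
  obtain ⟨c, hc⟩ := ValEq.exists w hz0
  by_contra h
  have hc0 : c < 0 := by
    by_contra! h'
    exact h (hc.ge.mono h')
  have := ((hc.pow p).sub (hc.ge.mono (by nlinarith))).le hz
  nlinarith

namespace RamificationLevel

/-- How the ramification data change in an Artin–Schreier extension. -/
lemma artinSchreier [CharP L p] (h : RamificationLevel p w θ E (p * q) C) {E' : Subfield L}
    (hE : E ≤ E') {z : L} (hzE : z ∈ E')
    (hexp : ∀ x ∈ E', ∃ a : ℕ → L, (∀ i, a i ∈ E) ∧ x = ∑ i ∈ Finset.range p, a i * z ^ i)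
    (hxE : z ^ p - z ∈ E) {a : ℤ} (ha : 0 < a) (hpa : ¬ (p : ℤ) ∣ a)
    (hx : ValEq w (-(p * q * a)) (z ^ p - z)) :
    RamificationLevel p w θ E' q (C + (p - 1) * (q * a)) := by
  have hp1 : (1 : ℤ) < p := by exact_mod_cast hp.out.one_lt
  have hq : 0 < q := pos_of_mul_pos_right h.index_pos (by linarith)
  have hqa : 0 < q * a := mul_pos hq ha
  have hz : ValEq w (q * (-a)) z :=
    (ValEq.artinSchreier_root hqa (hx.congr (by ring))).congr (by ring)
  have hθz : ValEq w (-(p * q * a) - C) (θ z) := by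
    have h1 := ((h.der _ hxE (-a) (hx.congr (by ring))).2.1 (by rwa [dvd_neg])).neg
    rw [map_sub, derivation_pow_char, zero_sub, neg_neg] at h1
    exact h1.congr (by ring)
  have hco : IsCoprime (-a) (p : ℤ) :=
    ((Prime.coprime_iff_not_dvd (Nat.prime_iff_prime_int.1 hp.out)).2 hpa).symm.neg_left
  have hdom : ∀ x ∈ E', x ≠ 0 → ∃ f : ℕ → L, (∀ i, f i ∈ E) ∧
      x = ∑ i ∈ Finset.range p, f i * z ^ i ∧ ∃ j ∈ Finset.range p, ∃ α : ℤ,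
      ValEq w (p * q * α) (f j) ∧ ValEq w (q * (p * α - j * a)) x ∧
      ∀ i ∈ Finset.range p, i ≠ j → ValGE w (q * (p * α - j * a) + 1) (f i * z ^ i) := by
    intro x hx0 hxne
    obtain ⟨f, hf, rfl⟩ := hexp x hx0
    have h0 : ∃ i ∈ Finset.range p, f i * z ^ i ≠ 0 := by
      by_contra! h
      exact hxne (Finset.sum_eq_zero h)
    obtain ⟨j, hj, c, hc, hd, hsum⟩ := exists_dominant
      (val_ne_of_coprime_expansion hq.ne' hco hz fun i hi => h.val _ (hf i) hi) h0
    obtain ⟨α, hα⟩ := h.val _ (hf j) (left_ne_zero_of_mul hc.ne_zero)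
    have e : c = q * (p * α - j * a) := by
      rw [hc.unique (hα.mul (hz.pow j))]
      ring
    subst e
    exact ⟨f, hf, rfl, j, hj, α, hα, hsum, hd⟩
  have hterm : ∀ f ∈ E, ∀ i < p, ∀ α : ℤ, ValEq w (p * q * α) f →
      ValGE w (q * (p * α - i * a) - (C + (p - 1) * (q * a))) (θ (f * z ^ i)) ∧
      (i ≠ 0 → ValEq w (q * (p * α - i * a) - (C + (p - 1) * (q * a))) (θ (f * z ^ i))) ∧
      (i = 0 → ValGE w (q * (p * α - i * a) - (C + (p - 1) * (q * a)) + 1) (θ (f * z ^ i))) := by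
    intro f hf i hi α hα
    have h1 := (h.der f hf α hα).1
    have hpos : 0 < (p - 1) * (q * a) := mul_pos (by linarith) hqa
    have h2 : ValGE w (q * (p * α - i * a) - (C + (p - 1) * (q * a)) + 1) (z ^ i * θ f) :=
      ((hz.pow i).ge.mul h1).mono (by linarith)
    rw [Derivation.leibniz, smul_eq_mul, smul_eq_mul]
    have hz0 : i ≠ 0 → ValEq w (q * (p * α - i * a) - (C + (p - 1) * (q * a)))
        (f * θ (z ^ i)) := by
      intro hi0
      have hpi : ¬ (p : ℤ) ∣ (i : ℤ) := fun hd => by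
        have := Nat.le_of_dvd (Nat.pos_of_ne_zero hi0) (by exact_mod_cast hd)
        omega
      have h3 := ValEq.intCast (v := w) p hpi
      rw [Int.cast_natCast] at h3
      rw [Derivation.leibniz_pow, nsmul_eq_mul, smul_eq_mul]
      have hi1 : ((i - 1 : ℕ) : ℤ) = i - 1 := by
        have : 1 ≤ i := Nat.pos_of_ne_zero hi0
        push_cast [this]
        ring
      exact (hα.mul (h3.mul ((hz.pow (i - 1)).mul hθz))).congr (by rw [hi1]; ring)
    rcases Nat.eq_zero_or_pos i with rfl | hi0
    · have e : f * θ (z ^ 0) + z ^ 0 * θ f = z ^ 0 * θ f := by simp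
      rw [e]
      exact ⟨h2.mono (by linarith), fun h => absurd rfl h, fun _ => h2⟩
    · have h3 := (hz0 hi0.ne').add h2
      exact ⟨h3.ge, fun _ => h3, fun h => absurd h hi0.ne'⟩
  refine ⟨hq, fun x hx0 hxne => ?_, ?_, fun x hx0 => ?_, fun x hx0 b hb => ?_⟩
  · obtain ⟨f, -, -, j, -, α, -, hval, -⟩ := hdom x hx0 hxne
    exact ⟨_, hval⟩
  · obtain ⟨π, hπE, hπ⟩ := h.unif
    obtain ⟨α, β, hαβ⟩ := hco
    refine ⟨z ^ α * π ^ β, mul_mem (zpow_mem hzE α) (zpow_mem (hE hπE) β),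
      ((hz.zpow α).mul (hπ.zpow β)).congr ?_⟩
    linear_combination q * hαβ
  · obtain ⟨b, hb, hrest⟩ := h.res x hx0
    exact ⟨b, hE hb, hrest⟩
  · obtain ⟨f, hf, hsum, j, hj, α, hα, hval, hd⟩ := hdom x hx0 hb.ne_zero
    have hbα : b = p * α - j * a := mul_left_cancel₀ hq.ne' (hb.unique hval)
    subst hbα
    have hothers : ∀ i ∈ Finset.range p, i ≠ j →
        ValGE w (q * (p * α - j * a) - (C + (p - 1) * (q * a)) + 1) (θ (f i * z ^ i)) := by
      intro i hi hij
      by_cases h0 : f i = 0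
      · rw [h0, zero_mul, map_zero]; exact ValGE.zero
      obtain ⟨β, hβ⟩ := h.val _ (hf i) h0
      have h1 := (hβ.mul (hz.pow i)).le (hd i hi hij)
      exact (hterm _ (hf i) i (Finset.mem_range.1 hi) β hβ).1.mono (by linarith)
    obtain ⟨t1, t2, t3⟩ := hterm _ (hf j) j (Finset.mem_range.1 hj) α hα
    rw [hsum, map_sum]
    refine ⟨ValGE.sum fun i hi => ?_, fun hpb => ValEq.sum_of_dominant hj (t2 ?_) hothers,
      fun hpb => ValGE.sum fun i hi => ?_⟩
    · by_cases hij : i = j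
      · rw [hij]; exact t1
      · exact (hothers i hi hij).mono (by linarith)
    · rintro rfl
      exact hpb ⟨α, by push_cast; ring⟩
    · by_cases hij : i = j
      · rw [hij]
        refine t3 ?_
        have h1 : (p : ℤ) ∣ j * a := by
          have := (dvd_sub_right (Dvd.intro α rfl : (p : ℤ) ∣ p * α)).1 hpb
          exact this
        have h2 : (p : ℤ) ∣ j :=
          ((Nat.prime_iff_prime_int.1 hp.out).dvd_or_dvd h1).resolve_right hpa
        exact Nat.eq_zero_of_dvd_of_lt (by exact_mod_cast h2) (Finset.mem_range.1 hj)
      · exact hothers i hi hij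

end RamificationLevel

end Tower

section Induction

open WittVector

variable {p : ℕ} [hp : Fact p.Prime] {L : Type*} [Field L]

lemma truncate_verschiebung_cancel {R : Type*} [CommRing R] {r : ℕ} {x y : WittVector p R}
    (h : truncate (r + 1) (verschiebung x) = truncate (r + 1) (verschiebung y)) :
    truncate r x = truncate r y :=
  truncate_eq_iff.2 fun i hi => by
    have := truncate_eq_iff.1 h (i + 1) (by omega)
    rwa [verschiebung_coeff_add_one, verschiebung_coeff_add_one] at this

lemma witt_sub_coeff_zero {R : Type*} [CommRing R] (x y : WittVector p R) :
    (x - y).coeff 0 = x.coeff 0 - y.coeff 0 :=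
  map_sub (constantCoeff : WittVector p R →+* R) x y

lemma verschiebung_sub {R : Type*} [CommRing R] (x y : WittVector p R) :
    verschiebung (x - y) = verschiebung x - verschiebung y :=
  map_sub (verschiebung : WittVector p R →+ WittVector p R) x y

lemma coeff_zero_of_truncate_eq {R : Type*} [CommRing R] {r : ℕ} {x y z : WittVector p R}
    (h : truncate (r + 1) (x - y) = truncate (r + 1) z) :
    x.coeff 0 - y.coeff 0 = z.coeff 0 := by
  rw [← truncate_eq_iff.1 h 0 (Nat.succ_pos r), witt_sub_coeff_zero]

lemma map_eq_self_of_mem_wittSubring {E : Subfield L} {τ : L →+* L} (h : ∀ x ∈ E, τ x = x)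
    {g : WittVector p L} (hg : g ∈ wittSubring p E.toSubring) : WittVector.map τ g = g := by
  ext i
  rw [map_coeff]
  exact h _ (mem_wittSubring.1 hg i)

lemma eq_verschiebung_of_coeff_zero {R : Type*} [CommRing R] {x : WittVector p R}
    (h : x.coeff 0 = 0) : x = verschiebung (x.shift 1) := by
  conv_lhs => rw [witt_eq_teichmuller_add_verschiebung x, h, teichmuller_zero, zero_add]

lemma frobenius_sub_sub {R : Type*} [CommRing R] (y g : WittVector p R) :
    frobenius (y - g) - (y - g) = (frobenius y - y) - (frobenius g - g) := by
  rw [map_sub]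
  ring

variable {w : AddValuation L (WithTop ℤ)} {θ : Derivation ℤ L L}

lemma WittFil.teichmuller {r : ℕ} {μ : ℤ} {z : L} (h : ValGE w (-μ) (z ^ p ^ (r - 1))) :
    WittFil w r μ (teichmuller p z) := by
  intro i hi
  rcases Nat.eq_zero_or_pos i with rfl | hi0
  · rwa [teichmuller_coeff_zero]
  · rw [teichmuller_coeff_pos _ _ _ hi0, zero_pow (pow_pos hp.out.pos _).ne']
    exact ValGE.zero

lemma wittDer_teichmuller (r : ℕ) (z : L) :
    wittDer θ (r + 1) (teichmuller p z) = z ^ (p ^ r - 1) * θ z := by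
  rw [wittDer, Finset.sum_range_succ']
  simp only [teichmuller_coeff_zero, teichmuller_coeff_pos _ _ _ (Nat.succ_pos _), map_zero,
    mul_zero, Finset.sum_const_zero, zero_add, Nat.add_sub_cancel, Nat.sub_zero]

/-- Splitting off the bottom layer of an Artin–Schreier–Witt extension: after a change of
variables the first equation is an Artin–Schreier equation with a pole prime to `p`. -/
lemma RamificationLevel.exists_bottom [CharP L p] {E : Subfield L} {q C : ℤ}
    (h : RamificationLevel p w θ E (p * q) C) {t : L} (ht : ValEq w 1 t) {r : ℕ} {μ : ℤ}
    {x y : WittVector p L} (hx : x ∈ wittSubring p E.toSubring)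
    (hy : truncate (r + 1) (frobenius y - y) = truncate (r + 1) x)
    (hμ : 0 < μ) (hfil : WittFil w (r + 1) μ x)
    (hder : ValEq w (-μ - C) (wittDer θ (r + 1) x))
    {τ : L →+* L} (hτ : ∀ x, ValGE w 0 x → ValGE w 1 (τ x - x)) (hτE : ∀ x ∈ E, τ x = x)
    (hτy : truncate 1 (WittVector.map τ y - y) = truncate 1 (1 : WittVector p L)) :
    ∃ x₁ ∈ wittSubring p E.toSubring, ∃ g ∈ wittSubring p E.toSubring,
      truncate (r + 1) (frobenius (y - g) - (y - g)) = truncate (r + 1) x₁ ∧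
      WittFil w (r + 1) μ x₁ ∧ ValEq w (-μ - C) (wittDer θ (r + 1) x₁) ∧
      ∃ (E' : Subfield L) (a : ℤ), 0 < a ∧ ¬ (p : ℤ) ∣ a ∧ E ≤ E' ∧ (y - g).coeff 0 ∈ E' ∧
        ValEq w (-(p * q * a)) (x₁.coeff 0) ∧ ValEq w (q * -a) ((y - g).coeff 0) ∧
        (y - g).coeff 0 ^ p - (y - g).coeff 0 = x₁.coeff 0 ∧
        RamificationLevel p w θ E' q (C + (p - 1) * (q * a)) ∧
        ∀ τ : L →+* L, (∀ x ∈ E, τ x = x) → τ ((y - g).coeff 0) = (y - g).coeff 0 →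
          ∀ x ∈ E', τ x = x := by
  have hp1 : (1 : ℤ) < p := by exact_mod_cast hp.out.one_lt
  have hq : 0 < q := pos_of_mul_pos_right h.index_pos (by linarith)
  have hyg : ∀ g, truncate (r + 1) (frobenius (y - g) - (y - g)) =
      truncate (r + 1) (x - (frobenius g - g)) := fun g => by
    rw [frobenius_sub_sub, map_sub, hy, map_sub (truncate (r + 1)) x]
  have hroot : ∀ g, (y - g).coeff 0 ^ p - (y - g).coeff 0 = (x - (frobenius g - g)).coeff 0 :=
    fun g => by
    rw [← coeff_zero_of_truncate_eq (hyg g), coeff_frobenius_charP]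
  have hneg : ∀ g ∈ wittSubring p E.toSubring,
      ¬ ValGE w 0 ((x - (frobenius g - g)).coeff 0) := by
    intro g hg hc
    rw [← hroot g] at hc
    have h1 := hτ _ (valGE_artinSchreier_root hc)
    have h2 : τ ((y - g).coeff 0) - (y - g).coeff 0 = 1 := by
      have h3 : WittVector.map τ (y - g) - (y - g) = WittVector.map τ y - y := by
        rw [map_sub, map_eq_self_of_mem_wittSubring hτE hg]
        ring
      rw [← h3] at hτy
      have h4 := coeff_zero_of_truncate_eq hτy
      rw [map_coeff] at h4
      rw [h4, one_coeff_zero]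
    rw [h2] at h1
    have := ValEq.one.le h1
    omega
  obtain ⟨g, hg, hfil₁, hder₁, a, ha, hpa, hval⟩ :=
    h.exists_normalization ht (Nat.succ_pos r) hμ hx hfil hder hneg
  have hx₁ := RamificationLevel.sub_frobenius_sub_mem hx hg
  have hzE : (y - g).coeff 0 ^ p - (y - g).coeff 0 ∈ E := hroot g ▸ mem_wittSubring.1 hx₁ 0
  obtain ⟨E', hE, hz, hexp⟩ := exists_artinSchreier_subfield E hzE
  have hval' := hval
  rw [← hroot g] at hval'
  refine ⟨_, hx₁, g, hg, hyg g, hfil₁, hder₁, E', a, ha, hpa, hE, hz, hval, ?_, hroot g,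
    h.artinSchreier hE hz hexp hzE ha hpa hval', fun τ' hτ' hτz b hb => ?_⟩
  · exact (ValEq.artinSchreier_root (mul_pos hq ha) (hval'.congr (by ring))).congr (by ring)
  · obtain ⟨f, hf, rfl⟩ := hexp b hb
    rw [map_sum]
    exact Finset.sum_congr rfl fun i _ => by rw [map_mul, map_pow, hτz, hτ' _ (hf i)]

/-- Induction along the tower of subextensions of an Artin–Schreier–Witt extension. -/
lemma RamificationLevel.exists_top [CharP L p] {t : L} (ht : ValEq w 1 t) (r : ℕ) :
    ∀ {E : Subfield L} {C μ : ℤ} {x y : WittVector p L} {τ : ℕ → L →+* L},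
      RamificationLevel p w θ E ((p : ℤ) ^ (r + 1)) C → x ∈ wittSubring p E.toSubring →
      truncate (r + 1) (frobenius y - y) = truncate (r + 1) x →
      0 < μ → (p : ℤ) ^ (r + 1) ∣ μ → WittFil w (r + 1) μ x →
      ValEq w (-μ - C) (wittDer θ (r + 1) x) →
      (∀ i, ∀ x, ValGE w 0 x → ValGE w 1 (τ i x - x)) →
      (∀ i ≤ r, (∀ x ∈ E, τ i x = x) ∧ truncate (i + 1) (WittVector.map (τ i) y - y) =
        truncate (i + 1) (verschiebung^[i] (1 : WittVector p L))) →
      ∃ (E' : Subfield L) (a : ℤ) (z : L), RamificationLevel p w θ E' 1 (μ + C - a) ∧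
        0 < a ∧ ¬ (p : ℤ) ∣ a ∧ ValEq w (-a) z ∧ τ r z = z + 1 := by
  have hp1 : (1 : ℤ) < p := by exact_mod_cast hp.out.one_lt
  induction r with
  | zero =>
    intro E C μ x y τ h hx hy hμ hdvd hfil hder hτ hfix
    obtain ⟨hfix0, hτy⟩ := hfix 0 le_rfl
    rw [pow_succ'] at h
    obtain ⟨x₁, hx₁, g, hg, hy₁, hfil₁, hder₁, E', a, ha, hpa, hE, hzE, hxval, hzval, hroot,
      hlevel, -⟩ := h.exists_bottom ht hx hy hμ hfil hder (hτ 0) hfix0 hτy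
    have hE1 : ValEq w (p * p ^ 0 * -a - C) (θ (x₁.coeff 0)) :=
      (h.der _ (mem_wittSubring.1 hx₁ 0) (-a) (hxval.congr (by ring))).2.1 (by rwa [dvd_neg])
    have hμa : μ = p * a := by
      have h1 : wittDer θ (0 + 1) x₁ = θ (x₁.coeff 0) := by simp [wittDer]
      rw [h1] at hder₁
      have := hder₁.unique hE1
      simp only [pow_zero] at this
      linarith
    have hC : C + (p - 1) * ((p : ℤ) ^ 0 * a) = μ + C - a := by rw [hμa]; ring
    rw [hC, pow_zero] at hlevel
    refine ⟨E', a, (y - g).coeff 0, hlevel, ha, hpa, hzval.congr (by ring), ?_⟩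
    have h3 : WittVector.map (τ 0) (y - g) - (y - g) = WittVector.map (τ 0) y - y := by
      rw [map_sub, map_eq_self_of_mem_wittSubring hfix0 hg]
      ring
    rw [← h3] at hτy
    have h4 := coeff_zero_of_truncate_eq hτy
    rw [map_coeff, Function.iterate_zero_apply] at h4
    rw [← sub_eq_iff_eq_add', h4, one_coeff_zero]
  | succ r ih =>
    intro E C μ x y τ h hx hy hμ hdvd hfil hder hτ hfix
    obtain ⟨hfix0, hτy⟩ := hfix 0 (Nat.zero_le _)
    rw [pow_succ'] at h
    obtain ⟨x₁, hx₁, g, hg, hy₁, hfil₁, hder₁, E', a, ha, hpa, hE, hzE, hxval, hzval, hroot,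
      hlevel, hfixE'⟩ := h.exists_bottom ht hx hy hμ hfil hder (hτ 0) hfix0 hτy
    set q : ℤ := (p : ℤ) ^ (r + 1) with hq
    set z := (y - g).coeff 0 with hz
    have hq1 : 1 < q := one_lt_pow₀ hp1 (Nat.succ_ne_zero r)
    have hqa : 0 < q * a := by positivity
    have hcast : ((p ^ (r + 1) : ℕ) : ℤ) = q := by rw [hq]; push_cast; rfl
    have hPμ : q * (p * (q * a)) ≤ μ := by
      have h1 := hfil₁ 0 (Nat.succ_pos _)
      rw [Nat.sub_zero, Nat.add_sub_cancel] at h1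
      have h2 := (hxval.pow (p ^ (r + 1))).le h1
      rw [hcast] at h2
      linarith
    have hμq : p * (q * a) < μ := by nlinarith [mul_pos (by linarith : (0:ℤ) < p) hqa]
    have hderz : ValGE w (-μ - C + 1) (wittDer θ (r + 1 + 1) (teichmuller p z)) := by
      rw [wittDer_teichmuller]
      have h1 := (hlevel.pow_mul_der hzE hzval (pow_pos hp.out.pos (r + 1))).1
      rw [hcast] at h1
      refine h1.mono ?_
      have : 0 < (p - 1) * (q - 1) * (q * a) := by
        have : 0 < (p : ℤ) - 1 := by linarith
        have : 0 < q - 1 := by linarith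
        positivity
      linarith
    set X := x₁ - (frobenius (teichmuller p z) - teichmuller p z) with hX
    have hzW : teichmuller p z ∈ wittSubring p E'.toSubring := teichmuller_mem_wittSubring hzE
    have hXE : X ∈ wittSubring p E'.toSubring :=
      RamificationLevel.sub_frobenius_sub_mem
        (mem_wittSubring.2 fun i => hE (mem_wittSubring.1 hx₁ i)) hzW
    have hXfil : WittFil w (r + 1 + 1) μ X := by
      refine hfil₁.sub ht (WittFil.sub ht ?_ ?_)
      · rw [frobenius_teichmuller_charP]
        refine WittFil.teichmuller (((hzval.pow p).pow _).ge.mono ?_)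
        rw [Nat.add_sub_cancel, hcast]
        linarith
      · refine WittFil.teichmuller ((hzval.pow _).ge.mono ?_)
        rw [Nat.add_sub_cancel, hcast]
        nlinarith [mul_pos (by linarith : (0 : ℤ) < q) hqa]
    have hXder : ValEq w (-μ - C) (wittDer θ (r + 1 + 1) X) := by
      rw [hX, wittDer_sub_frobenius_sub]
      exact hder₁.add hderz
    have hX0 : X.coeff 0 = 0 := by
      rw [hX, witt_sub_coeff_zero, witt_sub_coeff_zero, coeff_frobenius_charP,
        teichmuller_coeff_zero, hroot, sub_self]
    have hXV := eq_verschiebung_of_coeff_zero hX0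
    set X' := X.shift 1 with hX'
    have hX'E : X' ∈ wittSubring p E'.toSubring :=
      mem_wittSubring.2 fun i => by
        rw [hX', shift_coeff]
        exact mem_wittSubring.1 hXE _
    rw [hXV, wittDer_verschiebung] at hXder
    rw [hXV, WittFil.verschiebung_iff] at hXfil
    have hy0 : (y - g - teichmuller p z).coeff 0 = 0 := by
      rw [witt_sub_coeff_zero, teichmuller_coeff_zero, ← hz, sub_self]
    have hyV := eq_verschiebung_of_coeff_zero hy0
    set y' := (y - g - teichmuller p z).shift 1 with hy'
    have hyX : truncate (r + 1) (frobenius y' - y') = truncate (r + 1) X' := by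
      apply truncate_verschiebung_cancel
      rw [← hXV, verschiebung_sub, verschiebung_frobenius_comm, ← hyV, frobenius_sub_sub,
        map_sub (truncate _), hy₁, hX, ← map_sub (truncate _)]
    have hμ' : 0 < μ - (p - 1) * (q * a) := by linarith
    have hqμ : q ∣ μ := (Dvd.intro_left _ (pow_succ' (p : ℤ) (r + 1)).symm).trans hdvd
    have hqμ' : q ∣ μ - (p - 1) * (q * a) := dvd_sub hqμ ⟨(p - 1) * a, by ring⟩
    obtain ⟨g', hg', hfil', hder'⟩ := hlevel.exists_reduction ht hμ'
      (sub_le_self μ (mul_nonneg (by linarith) hqa.le)) (by nlinarith) hqμ hqμ' hX'E hXfil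
      (hXder.congr (by ring))
    have hτfix : ∀ i ≤ r, ∀ x ∈ E', τ (i + 1) x = x := by
      intro i hi
      obtain ⟨h1, h2⟩ := hfix (i + 1) (by omega)
      refine hfixE' _ h1 ?_
      have h3 : WittVector.map (τ (i + 1)) (y - g) - (y - g) =
          WittVector.map (τ (i + 1)) y - y := by
        rw [map_sub, map_eq_self_of_mem_wittSubring h1 hg]
        ring
      rw [← h3] at h2
      have h4 := coeff_zero_of_truncate_eq h2
      rw [map_coeff, Function.iterate_succ_apply', verschiebung_coeff_zero] at h4
      exact sub_eq_zero.1 h4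
    obtain ⟨F, a', z', hF, hrest⟩ := ih (y := y' - g') (τ := fun i => τ (i + 1)) hlevel
      (RamificationLevel.sub_frobenius_sub_mem hX'E hg')
      (by rw [frobenius_sub_sub, map_sub, hyX, ← map_sub (truncate _)]) hμ' hqμ' hfil' hder'
      (fun i => hτ (i + 1)) (fun i hi => ⟨hτfix i hi, by
        obtain ⟨h1, h2⟩ := hfix (i + 1) (by omega)
        apply truncate_verschiebung_cancel
        rw [← Function.iterate_succ_apply' verschiebung i, ← h2]
        have h3 := map_eq_self_of_mem_wittSubring (hτfix i hi) hg'
        have h4 := map_eq_self_of_mem_wittSubring (hτfix i hi) hzW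
        have h5 := map_eq_self_of_mem_wittSubring h1 hg
        have h7 : WittVector.map (τ (i + 1)) (y - g - teichmuller p z) =
            WittVector.map (τ (i + 1)) y - g - teichmuller p z := by
          rw [map_sub, map_sub, h4, h5]
        have h6 : WittVector.map (τ (i + 1)) (y' - g') - (y' - g') =
            WittVector.map (τ (i + 1)) y' - y' := by
          rw [map_sub, h3]
          ring
        rw [h6, verschiebung_sub, ← map_verschiebung, ← hyV, h7]
        congr 1
        ring⟩)
    refine ⟨F, a', z', ?_, hrest⟩
    have hC : μ - (p - 1) * (q * a) + (C + (p - 1) * (q * a)) - a' = μ + C - a' := by ring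
    rwa [hC] at hF

end Induction

section GaloisAction

open WittVector

variable {p : ℕ} [hp : Fact p.Prime]

lemma truncate_map_congr {R S : Type*} [CommRing R] [CommRing S] (f : R →+* S) {n : ℕ}
    {x y : WittVector p R} (h : truncate n x = truncate n y) :
    truncate n (WittVector.map f x) = truncate n (WittVector.map f y) :=
  truncate_eq_iff.2 fun i hi => by rw [map_coeff, map_coeff, truncate_eq_iff.1 h i hi]

lemma frobenius_map {R S : Type*} [CommRing R] [CommRing S] [CharP R p] [CharP S p] (f : R →+* S)
    (x : WittVector p R) : frobenius (WittVector.map f x) = WittVector.map f (frobenius x) := by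
  ext i
  rw [coeff_frobenius_charP, map_coeff, map_coeff, coeff_frobenius_charP, map_pow]

lemma frobenius_iterate_verschiebung_one {R : Type*} [CommRing R] [CharP R p] (j : ℕ) :
    frobenius (verschiebung^[j] (1 : WittVector p R)) = verschiebung^[j] 1 := by
  have hc : Function.Commute (frobenius : WittVector p R → _) verschiebung :=
    fun z => (verschiebung_frobenius_comm z).symm
  rw [(hc.iterate_right j).eq, map_one]

lemma map_iterate_verschiebung_one {R S : Type*} [CommRing R] [CommRing S] (f : R →+* S)
    (j : ℕ) : WittVector.map f (verschiebung^[j] (1 : WittVector p R)) = verschiebung^[j] 1 := by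
  induction j with
  | zero => exact map_one _
  | succ j ih => rw [Function.iterate_succ_apply', Function.iterate_succ_apply',
      map_verschiebung, ih]

lemma card_pow_char_eq_self_le {L : Type*} [Field L] :
    Finite {a : L // a ^ p = a} ∧ Nat.card {a : L // a ^ p = a} ≤ p := by
  classical
  let f : Polynomial L := Polynomial.X ^ p - Polynomial.X
  have hdeg : f.natDegree = p := FiniteField.X_pow_card_sub_X_natDegree_eq L hp.out.one_lt
  have hf : f ≠ 0 := FiniteField.X_pow_card_sub_X_ne_zero L hp.out.one_lt
  have hsub : {a : L | a ^ p = a} ⊆ (f.roots.toFinset : Set L) := fun a ha => by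
    rw [Finset.mem_coe, Multiset.mem_toFinset, Polynomial.mem_roots hf]
    simp only [f, Polynomial.IsRoot, Polynomial.eval_sub, Polynomial.eval_pow, Polynomial.eval_X]
    exact sub_eq_zero.2 ha
  refine ⟨(Finset.finite_toSet _).subset hsub, ?_⟩
  refine (Nat.card_mono (Finset.finite_toSet _) hsub).trans ?_
  rw [Nat.card_coe_set_eq, Set.ncard_coe_finset]
  exact (Multiset.toFinset_card_le _).trans ((Polynomial.card_roots' f).trans hdeg.le)

variable {K L : Type*} [Field K] [Field L] [Algebra K L] [CharP L p]

/-- The Galois group of a maximal Artin–Schreier–Witt extension contains automorphisms which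
translate the solution by any given constant. -/
lemma exists_galois_translation [IsGalois K L] [FiniteDimensional K L] {n : ℕ}
    (hdeg : Module.finrank K L = p ^ n) {x : WittVector p K} {y : WittVector p L}
    (hy : truncate n (frobenius y - y) = truncate n (WittVector.map (algebraMap K L) x))
    (hgen : ∀ σ τ : L ≃ₐ[K] L, (∀ i < n, σ (y.coeff i) = τ (y.coeff i)) → σ = τ)
    {c : WittVector p L} (hc : frobenius c = c) :
    ∃ σ : L ≃ₐ[K] L, truncate n (WittVector.map (σ : L →+* L) y - y) = truncate n c := by
  have hfix : ∀ σ : L ≃ₐ[K] L, ∀ i : Fin n,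
      (WittVector.map (σ : L →+* L) y - y).coeff i ^ p =
        (WittVector.map (σ : L →+* L) y - y).coeff i := by
    intro σ i
    rw [← coeff_frobenius_charP]
    refine (truncate_eq_iff (r := n)).1 ?_ i i.2
    have h1 := truncate_map_congr (σ : L →+* L) hy
    have h2 : WittVector.map (σ : L →+* L) (WittVector.map (algebraMap K L) x) =
        WittVector.map (algebraMap K L) x := by
      ext j
      simp only [map_coeff]
      exact σ.commutes _
    rw [h2, ← hy, map_sub (WittVector.map _), ← frobenius_map] at h1
    rw [← sub_eq_zero, ← map_sub] at h1 ⊢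
    rw [← h1, map_sub WittVector.frobenius]
    exact congrArg _ (by ring)
  obtain ⟨hfin, hcard⟩ := card_pow_char_eq_self_le (p := p) (L := L)
  let Φ : (L ≃ₐ[K] L) → Fin n → {a : L // a ^ p = a} := fun σ i => ⟨_, hfix σ i⟩
  have hinj : Function.Injective Φ := by
    intro σ τ h
    have h1 : truncate n (WittVector.map (σ : L →+* L) y - y) =
        truncate n (WittVector.map (τ : L →+* L) y - y) :=
      truncate_eq_iff.2 fun i hi => congrArg Subtype.val (congrFun h ⟨i, hi⟩)
    rw [map_sub (truncate n), map_sub (truncate n), sub_left_inj] at h1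
    exact hgen σ τ fun i hi => by
      have := truncate_eq_iff.1 h1 i hi
      rwa [map_coeff, map_coeff] at this
  have hbij := hinj.bijective_of_nat_card_le (by
    rw [IsGalois.card_aut_eq_finrank, hdeg, Nat.card_fun, Nat.card_fin]
    exact Nat.pow_le_pow_left hcard n)
  obtain ⟨σ, hσ⟩ := hbij.2 fun i => ⟨c.coeff i, by rw [← coeff_frobenius_charP, hc]⟩
  exact ⟨σ, truncate_eq_iff.2 fun i hi => congrArg Subtype.val (congrFun hσ ⟨i, hi⟩)⟩

lemma galois_translation_pow_eq_one {n : ℕ} {y : WittVector p L}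
    (hgen : ∀ σ τ : L ≃ₐ[K] L, (∀ i < n, σ (y.coeff i) = τ (y.coeff i)) → σ = τ)
    {σ : L ≃ₐ[K] L} {r : ℕ} (hr : n = r + 1)
    (hσ : truncate n (WittVector.map (σ : L →+* L) y - y) =
      truncate n (verschiebung^[r] (1 : WittVector p L))) : σ ^ p = 1 := by
  have h : ∀ j : ℕ, truncate n (WittVector.map ((σ ^ j : L ≃ₐ[K] L) : L →+* L) y - y) =
      truncate n (j • verschiebung^[r] (1 : WittVector p L)) := by
    intro j
    induction j with
    | zero =>
      have : WittVector.map (((σ ^ 0 : L ≃ₐ[K] L)) : L →+* L) y = y := by ext i; simp [map_coeff]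
      rw [this, sub_self, zero_smul]
    | succ j ih =>
      have h1 := truncate_map_congr (σ : L →+* L) ih
      rw [map_nsmul (WittVector.map _), map_iterate_verschiebung_one, map_sub (WittVector.map _)]
        at h1
      have h2 : WittVector.map (σ : L →+* L)
          (WittVector.map ((σ ^ j : L ≃ₐ[K] L) : L →+* L) y) =
          WittVector.map ((σ ^ (j + 1) : L ≃ₐ[K] L) : L →+* L) y := by
        ext i
        simp only [map_coeff, pow_succ']
        rfl
      rw [h2] at h1
      rw [add_smul, one_smul, map_add, ← h1, ← hσ, ← map_add]
      exact congrArg _ (by ring)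
  refine hgen _ _ fun i hi => ?_
  have h1 := h p
  have h2 : p • verschiebung^[r] (1 : WittVector p L) = verschiebung^[n] 1 := by
    rw [nsmul_eq_mul, mul_comm, ← verschiebung_frobenius, frobenius_iterate_verschiebung_one, hr,
      Function.iterate_succ_apply']
  have h3 : truncate n (verschiebung^[n] (1 : WittVector p L)) = 0 := by
    rw [← RingHom.mem_ker, mem_ker_truncate]
    exact fun i hi => iterate_verschiebung_coeff_eq_zero _ hi
  rw [h2, h3, map_sub, sub_eq_zero] at h1
  have := truncate_eq_iff.1 h1 i hi
  rw [map_coeff] at this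
  exact this

end GaloisAction

section Base

open WittVector

variable {p : ℕ} [hp : Fact p.Prime] {L : Type*} [Field L] {w : AddValuation L (WithTop ℤ)}
  {θ : Derivation ℤ L L}

/-- A Witt vector whose components have poles of orders prime to `p`. -/
lemma RamificationLevel.wittDer_of_not_dvd [CharP L p] {E : Subfield L} {q C : ℤ}
    (h : RamificationLevel p w θ E q C) {n : ℕ} (hn : 0 < n) {ν : Fin n → ℕ}
    (hν : ∀ i, ¬ p ∣ ν i) {x : WittVector p L} (hxE : x ∈ wittSubring p E.toSubring)
    (hx : ∀ i : Fin n, ValEq w (q * -(ν i : ℤ)) (x.coeff i)) {M : ℕ}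
    (hM : M = Finset.univ.sup fun i : Fin n => p ^ (n - 1 - i.val) * ν i) :
    WittFil w n (q * M) x ∧ ValEq w (-(q * M) - C) (wittDer θ n x) := by
  have hle : ∀ i : Fin n, p ^ (n - 1 - i.val) * ν i ≤ M := fun i =>
    hM ▸ Finset.le_sup (f := fun i : Fin n => p ^ (n - 1 - i.val) * ν i) (Finset.mem_univ i)
  have : Nonempty (Fin n) := ⟨⟨0, hn⟩⟩
  obtain ⟨j, -, hj⟩ := Finset.exists_mem_eq_sup Finset.univ Finset.univ_nonempty
    fun i : Fin n => p ^ (n - 1 - i.val) * ν i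
  rw [← hM] at hj
  have key : ∀ i j : Fin n, i < j → p ^ (n - 1 - i.val) * ν i ≠ p ^ (n - 1 - j.val) * ν j := by
    intro i j hij heq
    have hlt : n - 1 - j.val < n - 1 - i.val := by
      have := j.2
      have : i.val < j.val := hij
      omega
    obtain ⟨d, hd⟩ := Nat.exists_eq_add_of_lt hlt
    rw [hd, add_assoc, pow_add, mul_assoc] at heq
    have := Nat.eq_of_mul_eq_mul_left (pow_pos hp.out.pos _) heq
    exact hν j (this ▸ Dvd.dvd.mul_right (dvd_pow_self p (Nat.succ_ne_zero d)) _)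
  have hne : ∀ i : Fin n, i ≠ j → p ^ (n - 1 - i.val) * ν i < M := by
    intro i hij
    refine lt_of_le_of_ne (hle i) fun heq => ?_
    rcases lt_or_gt_of_ne hij with hlt | hlt
    · exact key _ _ hlt (heq.trans hj)
    · exact key _ _ hlt (hj.symm.trans heq.symm)
  have hval : ∀ i : Fin n, ValEq w (-(q * (p ^ (n - 1 - i.val) * ν i : ℕ)) - C)
      (x.coeff i ^ (p ^ (n - 1 - i.val) - 1) * θ (x.coeff i)) := by
    intro i
    refine ((h.pow_mul_der (mem_wittSubring.1 hxE i) (hx i) (pow_pos hp.out.pos _)).2.1 ?_).congr ?_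
    · rw [dvd_neg]
      exact_mod_cast hν i
    · push_cast
      ring
  refine ⟨fun i hi => ((hx ⟨i, hi⟩).pow _).ge.mono ?_, ?_⟩
  · have h1 : ((p ^ (n - 1 - i) * ν ⟨i, hi⟩ : ℕ) : ℤ) ≤ M := by exact_mod_cast hle ⟨i, hi⟩
    have := mul_le_mul_of_nonneg_left h1 h.index_pos.le
    push_cast at this ⊢
    linarith
  · refine ValEq.sum_of_dominant (Finset.mem_range.2 j.2) ((hval j).congr (by rw [hj]))
      fun i hi hij => ?_
    have hi' := Finset.mem_range.1 hi
    have h1 : ((p ^ (n - 1 - i) * ν ⟨i, hi'⟩ : ℕ) : ℤ) + 1 ≤ M := by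
      exact_mod_cast hne ⟨i, hi'⟩ fun h => hij (congrArg Fin.val h)
    refine (hval ⟨i, hi'⟩).ge.mono ?_
    have h2 := mul_le_mul_of_nonneg_left h1 h.index_pos.le
    have h3 := h.index_pos
    dsimp only
    linarith

/-- The bottom of the tower: the field `K = k((s))` with the derivation `s d/ds`. -/
lemma RamificationLevel.base {K k : Type*} [Field K] [Field k] [CharP k p] [PerfectField k]
    [Algebra K L] [FiniteDimensional K L] (ι : K ≃+* LaurentSeries k) {N : ℕ}
    (hN : Module.finrank K L = N) {t : L} (ht : ValEq w 1 t)
    (hK : ∀ x : K, x ≠ 0 → ValEq w (N * (ι x).order) (algebraMap K L x))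
    (hθ : ∀ a : K, θ (algebraMap K L a) = algebraMap K L (transportDerivation ι a)) :
    RamificationLevel p w θ (algebraMap K L).fieldRange N 0 := by
  have hN0 : (0 : ℤ) < N := by exact_mod_cast hN ▸ Module.finrank_pos
  have hK' : ∀ f : LaurentSeries k, f ≠ 0 →
      ValEq w (N * f.order) (algebraMap K L (ι.symm f)) := fun f hf => by
    have := hK (ι.symm f) (by simpa using hf)
    rwa [ι.apply_symm_apply] at this
  refine ⟨hN0, ?_, ?_, ?_, ?_⟩
  · rintro _ ⟨x, rfl⟩ hx
    exact ⟨_, hK x (by rintro rfl; exact hx (map_zero _))⟩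
  · refine ⟨_, ⟨ι.symm (HahnSeries.single 1 1), rfl⟩, ?_⟩
    exact (hK' _ (by simp)).congr (by rw [HahnSeries.order_single one_ne_zero, mul_one])
  · intro x hx
    obtain ⟨c, hc, hxc⟩ := exists_residue hN ht (fun x hx => ⟨_, hK x hx⟩) hx
    have hc0 : c ≠ 0 := by rintro rfl; exact hc.ne_zero (map_zero _)
    have hord : (ι c).order = 0 := by
      have := (hK c hc0).unique hc
      rcases mul_eq_zero.1 this with h | h
      · exact absurd h hN0.ne'
      · exact h
    obtain ⟨g, hg, hg0, hgc⟩ := exists_residue_pow p (by simpa using hc0) hord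
    refine ⟨_, ⟨ι.symm g, rfl⟩, (hK' g hg).congr (by rw [hg0, mul_zero]), ?_⟩
    have e : x - algebraMap K L (ι.symm g) ^ p =
        (x - algebraMap K L c) + algebraMap K L (ι.symm (ι c - g ^ p)) := by
      rw [map_sub, map_sub, ι.symm_apply_apply, map_pow, map_pow]
      ring
    change ValGE w 1 (x - algebraMap K L (ι.symm g) ^ p)
    rw [e]
    refine hxc.add ?_
    by_cases h0 : ι c - g ^ p = 0
    · rw [h0, map_zero, map_zero]; exact ValGE.zero
    · exact (hK' _ h0).ge.mono (by nlinarith [hgc h0])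
  · rintro _ ⟨x, rfl⟩ a ha
    have hx0 : x ≠ 0 := by rintro rfl; exact ha.ne_zero (map_zero _)
    obtain rfl : a = (ι x).order := mul_left_cancel₀ hN0.ne' (ha.unique (hK x hx0))
    change ValGE w _ (θ (algebraMap K L x)) ∧ (_ → ValEq w _ (θ (algebraMap K L x))) ∧
      (_ → ValGE w _ (θ (algebraMap K L x)))
    have hD : transportDerivation ι x = ι.symm (laurentEuler (ι x)) := by
      rw [← transportDerivation_apply, ι.symm_apply_apply]
    rw [hθ, hD]
    by_cases h0 : laurentEuler (ι x) = 0
    · rw [h0, map_zero, map_zero]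
      exact ⟨ValGE.zero, fun hpa =>
        absurd h0 (laurentEuler_order_eq p (by simpa using hx0) hpa).1, fun _ => ValGE.zero⟩
    · have h1 := hK' _ h0
      obtain ⟨h2, h3⟩ := laurentEuler_order p h0
      exact ⟨h1.ge.mono (by nlinarith), fun hpa => h1.congr (by
        rw [(laurentEuler_order_eq p (by simpa using hx0) hpa).2, sub_zero]),
        fun hpa => h1.ge.mono (by nlinarith [h3 hpa])⟩

end Base

section Count

lemma sum_ncard_upper {G : Type*} [One G] [Fintype G] [DecidableEq G] (e : ℕ) (i : G → ℤ)
    (hi : ∀ σ, σ ≠ 1 → 0 ≤ i σ ∧ i σ ≤ e + 1) :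
    ∑ j ∈ Finset.range (e + 1), (({σ : G | σ = 1 ∨ (j : ℤ) + 1 ≤ i σ} : Set G).ncard : ℤ) =
      e + 1 + ∑ σ ∈ Finset.univ.erase 1, i σ := by
  have h1 : ∀ j : ℕ, (({σ : G | σ = 1 ∨ (j : ℤ) + 1 ≤ i σ} : Set G).ncard : ℤ) =
      ∑ σ : G, if σ = 1 ∨ (j : ℤ) + 1 ≤ i σ then 1 else 0 := fun j => by
    rw [Set.ncard_eq_toFinset_card', Finset.sum_boole]
    congr 2
    ext σ
    simp
  simp only [h1]
  rw [Finset.sum_comm, ← Finset.add_sum_erase _ _ (Finset.mem_univ (1 : G))]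
  congr 1
  · simp
  · refine Finset.sum_congr rfl fun σ hσ => ?_
    have hσ1 := Finset.ne_of_mem_erase hσ
    obtain ⟨h0, hle⟩ := hi σ hσ1
    lift i σ to ℕ using h0 with m
    simp only [hσ1, false_or, Finset.sum_boole]
    have : (Finset.range (e + 1)).filter (fun j : ℕ => (j : ℤ) + 1 ≤ m) = Finset.range m := by
      ext j
      simp only [Finset.mem_filter, Finset.mem_range]
      omega
    rw [this, Finset.card_range]

lemma mem_zpowers_of_pow_prime_eq_one {G : Type*} [Group G] [Finite G] [IsCyclic G] {p : ℕ}
    [hp : Fact p.Prime] {n : ℕ} (hG : Nat.card G = p ^ n) {σ τ : G} (hσ : σ ^ p = 1)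
    (hτ : τ ≠ 1) : ∃ j : ℕ, σ = τ ^ j := by
  classical
  have := Fintype.ofFinite G
  obtain ⟨k, -, hk⟩ := (Nat.dvd_prime_pow hp.out).1 (hG ▸ orderOf_dvd_natCard τ)
  obtain ⟨k, rfl⟩ := Nat.exists_eq_succ_of_ne_zero (n := k) fun h0 =>
    hτ (orderOf_eq_one_iff.1 (by rw [hk, h0, pow_zero]))
  have ha : orderOf (τ ^ p ^ k) = p := by
    rw [orderOf_pow_of_dvd (pow_ne_zero _ hp.out.ne_zero) (hk ▸ pow_dvd_pow p k.le_succ), hk,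
      Nat.succ_eq_add_one, pow_succ, Nat.mul_div_cancel_left _ (pow_pos hp.out.pos _)]
  have hsub : (Finset.range p).image (fun j => (τ ^ p ^ k) ^ j) ⊆
      Finset.univ.filter fun x : G => x ^ p = 1 := by
    intro x hx
    obtain ⟨j, -, rfl⟩ := Finset.mem_image.1 hx
    refine Finset.mem_filter.2 ⟨Finset.mem_univ _, ?_⟩
    have h1 := pow_orderOf_eq_one (τ ^ p ^ k)
    rw [ha] at h1
    change ((τ ^ p ^ k) ^ j) ^ p = 1
    rw [← pow_mul, mul_comm j, pow_mul, h1, one_pow]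
  have hcard : ((Finset.range p).image fun j => (τ ^ p ^ k) ^ j).card = p := by
    rw [Finset.card_image_of_injOn, Finset.card_range]
    intro i hi j hj hij
    rw [Finset.coe_range, Set.mem_Iio] at hi hj
    exact pow_injOn_Iio_orderOf (by rwa [Set.mem_Iio, ha]) (by rwa [Set.mem_Iio, ha]) hij
  have hmem : σ ∈ (Finset.range p).image fun j => (τ ^ p ^ k) ^ j := by
    rw [Finset.eq_of_subset_of_card_le hsub
      (hcard.symm ▸ IsCyclic.card_pow_eq_one_le hp.out.pos), Finset.mem_filter]
    exact ⟨Finset.mem_univ _, hσ⟩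
  obtain ⟨j, -, rfl⟩ := Finset.mem_image.1 hmem
  exact ⟨p ^ k * j, (pow_mul _ _ _).symm⟩

end Count

section Different

variable {L : Type*} [Field L] {w : AddValuation L (WithTop ℤ)} {K : Type*} [Field K]
  [Algebra K L] {N : ℕ}

lemma ValEq.prod {ι : Type*} {s : Finset ι} {f : ι → L} {a : ι → ℤ}
    (h : ∀ i ∈ s, ValEq w (a i) (f i)) : ValEq w (∑ i ∈ s, a i) (∏ i ∈ s, f i) := by
  classical
  induction s using Finset.induction_on with
  | empty => simpa using ValEq.one
  | insert i s hi ih =>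
    rw [Finset.sum_insert hi, Finset.prod_insert hi]
    exact (h i (Finset.mem_insert_self i s)).mul
      (ih fun j hj => h j (Finset.mem_insert_of_mem hj))

/-- The different of a totally ramified extension, computed with a derivation. -/
lemma sum_galois_sub_valuation [DecidableEq (L ≃ₐ[K] L)] [FiniteDimensional K L] [IsGalois K L]
    {θ : Derivation ℤ L L}
    {p : ℕ} [Fact p.Prime] (h : RamificationLevel p w θ (algebraMap K L).fieldRange N 0)
    (hN : Module.finrank K L = N) {π : L} (hπ : ValEq w 1 π) {d : ℤ} (hd : ValEq w d (θ π))
    {i : (L ≃ₐ[K] L) → ℤ} (hi : ∀ σ, σ ≠ 1 → ValEq w (i σ) (σ π - π)) :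
    ∑ σ ∈ Finset.univ.erase 1, i σ = N - d := by
  have hK : ∀ x : K, x ≠ 0 → ∃ a : ℤ, ValEq w (N * a) (algebraMap K L x) := fun x hx =>
    h.val _ ⟨x, rfl⟩ (by simpa using hx)
  have hN0 : (0 : ℤ) < N := h.index_pos
  obtain ⟨c, hexp, j, hj, α, hα, hjα, hdom⟩ :=
    exists_dominant_expansion hN hπ hK ((hπ.pow N).congr (mul_one _))
  have hj0 : j = 0 := by
    have : (N : ℤ) ∣ j := ⟨1 - α, by linarith⟩
    exact Nat.eq_zero_of_dvd_of_lt (by exact_mod_cast this) (Finset.mem_range.1 hj)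
  subst hj0
  obtain rfl : α = 1 := mul_left_cancel₀ hN0.ne' (by push_cast at hjα; linarith)
  have hc0 : ValEq w (N * 1) (θ (algebraMap K L (c 0))) := by
    refine ((h.der _ ⟨c 0, rfl⟩ 1 hα).2.1 fun hd => ?_).congr (sub_zero _)
    exact (Fact.out : p.Prime).ne_one (by exact_mod_cast Int.eq_one_of_dvd_one (by positivity) hd)
  have hci : ∀ l ∈ Finset.range N, l ≠ 0 →
      ValGE w (N * 1 + 1) (θ (algebraMap K L (c l)) * π ^ l) := by
    intro l hl hl0
    by_cases h0 : c l = 0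
    · rw [h0, map_zero, map_zero, zero_mul]; exact ValGE.zero
    obtain ⟨β, hβ⟩ := hK _ h0
    have h1 := (hβ.mul (hπ.pow l)).le (hdom l hl hl0)
    have hlN : (l : ℤ) < N := by exact_mod_cast Finset.mem_range.1 hl
    have hβ1 : 1 ≤ β := by
      by_contra! hlt
      nlinarith
    have hl1 : (1 : ℤ) ≤ l := by exact_mod_cast Nat.pos_of_ne_zero hl0
    exact ((h.der _ ⟨c l, rfl⟩ β hβ).1.mul (hπ.pow l).ge).mono (by nlinarith)
  have hsum : ValEq w (N * 1) (∑ l ∈ Finset.range N, θ (algebraMap K L (c l)) * π ^ l) :=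
    ValEq.sum_of_dominant hj (by simpa using hc0) hci
  let f : Polynomial L := Polynomial.X ^ N -
    ∑ l ∈ Finset.range N, Polynomial.C (algebraMap K L (c l)) * Polynomial.X ^ l
  let P : Polynomial L := Lagrange.nodal Finset.univ fun σ : L ≃ₐ[K] L => σ π
  have hcard : (Finset.univ : Finset (L ≃ₐ[K] L)).card = N := by
    rw [Finset.card_univ, ← Nat.card_eq_fintype_card, IsGalois.card_aut_eq_finrank, hN]
  have hinj : Function.Injective fun σ : L ≃ₐ[K] L => σ π := by
    intro σ τ hστ
    ext x
    obtain ⟨b, rfl⟩ := exists_expansion hN hπ hK x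
    simp only [map_sum, map_mul, map_pow, AlgEquiv.commutes]
    exact Finset.sum_congr rfl fun l _ => by rw [show σ π = τ π from hστ]
  have hr : (∑ l ∈ Finset.range N, Polynomial.C (algebraMap K L (c l)) * Polynomial.X ^ l).degree <
      (N : WithBot ℕ) := by
    refine (Polynomial.degree_sum_le _ _).trans_lt ((Finset.sup_lt_iff (WithBot.bot_lt_coe N)).2
      fun l hl => (Polynomial.degree_C_mul_X_pow_le _ _).trans_lt ?_)
    exact WithBot.coe_lt_coe.2 (Finset.mem_range.1 hl)
  have hfP : f = P := by
    have hf : f.Monic := Polynomial.monic_X_pow_sub hr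
    have hfd : f.degree = N := by
      rw [Polynomial.degree_sub_eq_left_of_degree_lt (by rwa [Polynomial.degree_X_pow]),
        Polynomial.degree_X_pow]
    have hPd : P.degree = N := by rw [Lagrange.degree_nodal, hcard]
    refine Polynomial.eq_of_degree_sub_lt_of_eval_index_eq Finset.univ hinj.injOn ?_ fun σ hσ => ?_
    · rw [hcard, ← hfd]
      exact Polynomial.degree_sub_lt_left (hfd.trans hPd.symm) hf.ne_zero
        (hf.leadingCoeff.trans (Lagrange.nodal_monic (s := Finset.univ)).leadingCoeff.symm)
    · have h1 := congrArg σ hexp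
      simp only [map_sum, map_mul, map_pow, AlgEquiv.commutes] at h1
      refine Eq.trans ?_ 
        (Lagrange.eval_nodal_at_node (v := fun σ : L ≃ₐ[K] L => σ π) hσ).symm
      simp only [f, Polynomial.eval_sub, Polynomial.eval_finsetSum, Polynomial.eval_mul,
        Polynomial.eval_C, Polynomial.eval_pow, Polynomial.eval_X]
      rw [h1, sub_self]
  have hder : θ π * f.derivative.eval π =
      ∑ l ∈ Finset.range N, θ (algebraMap K L (c l)) * π ^ l := by
    have h1 := congrArg θ hexp
    rw [Derivation.leibniz_pow, map_sum] at h1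
    simp only [Derivation.leibniz, Derivation.leibniz_pow, Finset.sum_add_distrib] at h1
    simp only [f, Polynomial.derivative_sub, Polynomial.derivative_X_pow,
      Polynomial.derivative_sum, Polynomial.derivative_C_mul_X_pow, Polynomial.eval_sub,
      Polynomial.eval_mul, Polynomial.eval_C, Polynomial.eval_pow, Polynomial.eval_X,
      Polynomial.eval_finsetSum, mul_sub, Finset.mul_sum]
    rw [sub_eq_iff_eq_add, ← Finset.sum_add_distrib]
    simp only [smul_eq_mul, nsmul_eq_mul] at h1
    rw [mul_left_comm, mul_comm (θ π), h1, add_comm, ← Finset.sum_add_distrib]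
    exact Finset.sum_congr rfl fun l _ => by ring
  have hP : P.derivative.eval π = ∏ σ ∈ Finset.univ.erase (1 : L ≃ₐ[K] L), (π - σ π) := by
    have := Lagrange.eval_nodal_derivative_eval_node_eq (v := fun σ : L ≃ₐ[K] L => σ π)
      (Finset.mem_univ (1 : L ≃ₐ[K] L))
    rw [Lagrange.eval_nodal] at this
    exact this
  rw [← hder, hfP, hP] at hsum
  have hprod := ValEq.prod (w := w) (s := Finset.univ.erase (1 : L ≃ₐ[K] L)) (a := i)
    (f := fun σ => π - σ π) fun σ hσ => by
      rw [← neg_sub]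
      exact (hi σ (Finset.ne_of_mem_erase hσ)).neg
  have := (hd.mul hprod).unique hsum
  rw [mul_one] at this
  exact eq_sub_of_add_eq' this

end Different

section Assembly

open WittVector

variable {p : ℕ} [hp : Fact p.Prime] {K L : Type*} [Field K] [Field L] [Algebra K L]
  {w : AddValuation L (WithTop ℤ)} {N : ℕ}

lemma galois_ext_of_uniformizer [FiniteDimensional K L] (hN : Module.finrank K L = N) {t : L}
    (ht : ValEq w 1 t) (hK : ∀ x : K, x ≠ 0 → ∃ a : ℤ, ValEq w (N * a) (algebraMap K L x))
    {σ : L ≃ₐ[K] L} (hσ : σ t = t) : σ = 1 := by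
  ext x
  obtain ⟨b, rfl⟩ := exists_expansion hN ht hK x
  simp only [map_sum, map_mul, map_pow, AlgEquiv.commutes, hσ, AlgEquiv.one_apply]

lemma valGE_galois_pow_sub [FiniteDimensional K L] (hN : Module.finrank K L = N) {t : L}
    (ht : ValEq w 1 t) (hK : ∀ x : K, x ≠ 0 → ∃ a : ℤ, ValEq w (N * a) (algebraMap K L x))
    {σ : L ≃ₐ[K] L} {b : ℤ} {x : L} (hσ : ValGE w b (σ x - x)) (j : ℕ) :
    ValGE w b ((σ ^ j) x - x) := by
  induction j with
  | zero => rw [pow_zero, AlgEquiv.one_apply, sub_self]; exact ValGE.zero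
  | succ j ih =>
    have e : (σ ^ (j + 1)) x - x = σ ((σ ^ j) x - x) + (σ x - x) := by
      rw [pow_succ', AlgEquiv.mul_apply, map_sub]
      ring
    rw [e]
    exact (ih.galois hN ht hK σ).add hσ

/-- The ramification filtration of a cyclic Artin–Schreier–Witt extension of degree `p ^ n`: its
largest break `a`, and the sum of the valuations of the `σ t - t`. -/
lemma exists_largest_break {k : Type*} [Field k] [CharP k p] [PerfectField k] [CharP L p]
    [FiniteDimensional K L] [IsGalois K L] [IsCyclic (L ≃ₐ[K] L)] [DecidableEq (L ≃ₐ[K] L)]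
    (ι : K ≃+* LaurentSeries k) {n : ℕ} (hn : 0 < n) (hdeg : Module.finrank K L = p ^ n) {t : L}
    (ht : ValEq w 1 t)
    (hK : ∀ x : K, x ≠ 0 → ValEq w ((p ^ n : ℕ) * (ι x).order) (algebraMap K L x))
    {ν : Fin n → ℕ} (hν : ∀ i, 0 < ν i) (hνp : ∀ i, ¬ p ∣ ν i) {x : WittVector p K}
    (hx : ∀ i : Fin n, x.coeff i ≠ 0 ∧ (ι (x.coeff i)).order = -(ν i : ℤ)) {y : WittVector p L}
    (hy : truncate n (frobenius y - y) = truncate n (WittVector.map (algebraMap K L) x))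
    (hgen : ∀ σ τ : L ≃ₐ[K] L, (∀ i < n, σ (y.coeff i) = τ (y.coeff i)) → σ = τ) {M : ℕ}
    (hM : M = Finset.univ.sup fun i : Fin n => p ^ (n - 1 - i.val) * ν i) :
    ∃ (a : ℤ) (i : (L ≃ₐ[K] L) → ℤ), (∀ σ, σ ≠ 1 → ValEq w (i σ) (σ t - t)) ∧
      (∀ σ, σ ≠ 1 → 2 ≤ i σ ∧ i σ ≤ a + 1) ∧ (∃ σ, σ ≠ 1 ∧ i σ = a + 1) ∧
      ∑ σ ∈ Finset.univ.erase 1, i σ = p ^ n * (M + 1) - (a + 1) := by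
  obtain ⟨r, rfl⟩ : ∃ r, n = r + 1 := ⟨n - 1, by omega⟩
  have hcard : Nat.card (L ≃ₐ[K] L) = p ^ (r + 1) := by
    rw [IsGalois.card_aut_eq_finrank, hdeg]
  have hpow : ∀ σ : L ≃ₐ[K] L, σ ^ p ^ (r + 1) = 1 := fun σ => hcard ▸ pow_card_eq_one'
  have hpN : p ∣ p ^ (r + 1) := dvd_pow_self p r.succ_ne_zero
  have hK' : ∀ x : K, x ≠ 0 →
      ∃ a : ℤ, ValEq w ((p ^ (r + 1) : ℕ) * a) (algebraMap K L x) := fun x hx => ⟨_, hK x hx⟩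
  choose! σ hσ using fun j : ℕ =>
    exists_galois_translation hdeg hy hgen (frobenius_iterate_verschiebung_one j)
  have hσp : σ r ^ p = 1 := galois_translation_pow_eq_one hgen rfl (hσ r)
  obtain ⟨θ, hθ⟩ := exists_derivation_extension (L := L) (transportDerivation ι)
  have hbase := RamificationLevel.base (p := p) ι hdeg ht hK hθ
  have hM0 : 0 < M := by
    have h0 : p ^ (r + 1 - 1 - (0 : Fin (r + 1)).val) * ν 0 ≤ M := hM ▸
      Finset.le_sup (f := fun i : Fin (r + 1) => p ^ (r + 1 - 1 - i.val) * ν i)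
        (Finset.mem_univ 0)
    exact (Nat.mul_pos (pow_pos hp.out.pos _) (hν 0)).trans_le h0
  have hxE : WittVector.map (algebraMap K L) x ∈
      wittSubring p (algebraMap K L).fieldRange.toSubring :=
    mem_wittSubring.2 fun i => ⟨x.coeff i, (map_coeff _ _ _).symm⟩
  obtain ⟨hfil, hder⟩ := hbase.wittDer_of_not_dvd hn hνp hxE (fun i => by
    rw [map_coeff, ← (hx i).2]
    exact hK _ (hx i).1) hM
  have hN0 := hbase.index_pos
  obtain ⟨E', a, z, hlevel, ha, hpa, hz, hσz⟩ := RamificationLevel.exists_top ht r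
    (τ := fun j => (σ j : L →+* L)) (by exact_mod_cast hbase) hxE hy
    (mul_pos hN0 (by exact_mod_cast hM0)) (by push_cast; exact dvd_mul_right _ _) hfil hder
    (fun j x hx => valGE_one_galois_sub hdeg hpN ht hK' (hpow (σ j)) hx)
    (fun j hj => ⟨by rintro _ ⟨c, rfl⟩; exact (σ j).commutes c,
      truncate_eq_of_le (Nat.succ_le_succ hj) (hσ j)⟩)
  obtain ⟨π, hπE, hπ⟩ := hlevel.unif
  have hθπ := (hlevel.der π hπE 1 (hπ.congr (by norm_num))).2.1
    (by exact_mod_cast hp.out.one_lt.ne' ∘ Nat.dvd_one.1)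
  choose! i hi using fun (τ : L ≃ₐ[K] L) (hτ : τ ≠ 1) => ValEq.exists w
    (sub_ne_zero.2 fun h => hτ (galois_ext_of_uniformizer hdeg ht hK' h))
  have hi2 : ∀ τ, τ ≠ 1 → 2 ≤ i τ := fun τ hτ =>
    (hi τ hτ).le (valGE_two_galois_sub hdeg ht hK' (hpow τ))
  have hσ1 : σ r ≠ 1 := fun h => by
    have h1 : (σ r) z = z + 1 := hσz
    rw [h, AlgEquiv.one_apply] at h1
    exact one_ne_zero (left_eq_add.1 h1)
  have hiσ : i (σ r) = a + 1 := by
    have h1 := (galois_sub_expansion hdeg hpN ht hK' (hi2 _ hσ1) (hi _ hσ1) hz).2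
      (by rwa [dvd_neg])
    have h2 : (σ r) z - z = 1 := sub_eq_of_eq_add' hσz
    rw [h2] at h1
    linarith [h1.unique ValEq.one]
  refine ⟨a, i, hi, fun τ hτ => ⟨hi2 τ hτ, ?_⟩, ⟨σ r, hσ1, hiσ⟩, ?_⟩
  · obtain ⟨j, hj⟩ := mem_zpowers_of_pow_prime_eq_one hcard hσp hτ
    have h1 := valGE_galois_pow_sub hdeg ht hK' (hi τ hτ).ge j
    rw [← hj] at h1
    exact ((hi _ hσ1).le h1).trans hiσ.le
  · have hiπ : ∀ τ, τ ≠ 1 → ValEq w (i τ) (τ π - π) := fun τ hτ =>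
      ((galois_sub_expansion hdeg hpN ht hK' (hi2 τ hτ) (hi τ hτ) hπ).2
        (by exact_mod_cast hp.out.one_lt.ne' ∘ Nat.dvd_one.1)).congr (by ring)
    rw [sum_galois_sub_valuation hbase hdeg hπ hθπ hiπ]
    push_cast
    ring

lemma truncate_eq_of_map_eq {R S : Type*} [CommRing R] [CommRing S] {f : R →+* S}
    (hf : Function.Injective f) {n : ℕ} {x y : WittVector p R}
    (h : truncate n (WittVector.map f x) = truncate n (WittVector.map f y)) :
    truncate n x = truncate n y :=
  truncate_eq_iff.2 fun i hi => hf (by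
    rw [← map_coeff, ← map_coeff, truncate_eq_iff.1 h i hi])

lemma IntermediateField.algEquiv_ext_of_adjoin {K Ω : Type*} [Field K] [Field Ω] [Algebra K Ω]
    {S : Set Ω} {F : IntermediateField K Ω} (hF : F = IntermediateField.adjoin K S)
    {σ τ : F ≃ₐ[K] F} (h : ∀ z : F, (z : Ω) ∈ S → σ z = τ z) : σ = τ := by
  subst hF
  ext z
  exact congrArg Subtype.val (DFunLike.congr_fun
    (IntermediateField.algHom_ext_of_eq_adjoin (φ₁ := σ.toAlgHom) (φ₂ := τ.toAlgHom) _ rfl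
      fun x hx => h _ hx) z)

end Assembly

/-- In the Artin–Schreier–Witt setting — `K = k((s))` with `k` perfect of
characteristic `p`, and `L = K(y_0,…,y_{n−1})` where `F(y) − y = u` for a Witt vector `u` of
length `n` over `K` whose entries have poles of orders `ν_i` prime to `p`, so that `L/K` is
cyclic totally ramified of degree `p^n` — the conductor exponent (the value `φ(e)` of the
Herbrand function, i.e. `m` with `m + 1 = (Σ_{i=0}^{e} |G_i|)/p^n`) satisfies
`m(L/K) = max_{0≤i≤n−1} p^{n−1−i} ν_i`. -/
theorem asw_conductor (p : ℕ) [Fact p.Prime] (k : Type*) [Field k] [CharP k p] [PerfectField k]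
    (n : ℕ) (hn : 1 ≤ n)
    -- `K` is the field `k((s))` of Laurent series over `k`, with valuation `v_K = order ∘ ι`
    (K : Type*) [Field K] (ι : K ≃+* LaurentSeries k)
    -- the Witt vector `u` of length `n` over `K`, with pole orders `ν_i` prime to `p`
    (u : TruncatedWittVector p n K)
    (ν : Fin n → ℕ) (hν : ∀ i, 0 < ν i) (hνp : ∀ i, ¬ p ∣ ν i)
    (hu : ∀ i, u.coeff i ≠ 0)
    (hord : ∀ i, (ι (u.coeff i)).order = -(ν i : ℤ))
    -- a separable closure `Ω` of `K` and a solution `y` of `F(y) − y = u` with entries in `Ω`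
    (Ω : Type*) [Field Ω] [Algebra K Ω] [IsSepClosed Ω] [Algebra.IsSeparable K Ω]
    (y : TruncatedWittVector p n Ω)
    (hy : twFrobenius p n y - y = twMap p n (algebraMap K Ω) u)
    -- `L = K(y_0, …, y_{n−1})`, cyclic totally ramified of degree `p^n` over `K`
    (L : IntermediateField K Ω)
    (hL : L = IntermediateField.adjoin K (Set.range fun i => y.coeff i))
    [IsGalois K ↥L] [FiniteDimensional K ↥L] [IsCyclic (↥L ≃ₐ[K] ↥L)]
    (hdeg : Module.finrank K ↥L = p ^ n)
    -- the normalized valuation `v_L` and a uniformizer `t` of `L`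
    (v : ↥L → WithTop ℤ) (hv : IsAddValuation v) (t : ↥L) (ht : v t = 1)
    -- `L/K` is totally ramified: `v_L` restricts on `K` to `p^n` times the `s`-adic valuation
    (hvK : ∀ x : K, x ≠ 0 →
      v (algebraMap K ↥L x) = ((p ^ n * (ι x).order : ℤ) : WithTop ℤ))
    -- `e` is the largest integer with `G_e ≠ {1}`
    (e : ℕ) (he : ramGroup (K := K) v t e ≠ {1})
    (he' : ∀ i, e < i → ramGroup (K := K) v t i = {1})
    -- `m` is the conductor exponent: `m + 1 = (Σ_{i=0}^{e} |G_i|)/p^n`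
    (m : ℤ)
    (hm : (m + 1) * p ^ n =
      ∑ i ∈ Finset.range (e + 1), ((ramGroup (K := K) v t i).ncard : ℤ)) :
    m = ((Finset.univ.sup fun i : Fin n => p ^ (n - 1 - i.val) * ν i : ℕ) : ℤ) := by
  classical
  have : CharP K p :=
    charP_of_injective_ringHom (f := (ι.symm : LaurentSeries k →+* K).comp HahnSeries.C)
      (ι.symm.injective.comp HahnSeries.C_injective) p
  have : CharP L p := charP_of_injective_algebraMap (algebraMap K L).injective p
  have : CharP Ω p := charP_of_injective_algebraMap (algebraMap K Ω).injective p
  obtain ⟨hv0, hvmul, hvadd⟩ := hv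
  have hv1 : v 1 = 0 := by
    have h := hvmul 1 1
    rw [mul_one] at h
    lift v 1 to ℤ using fun h1 => one_ne_zero ((hv0 1).1 h1) with c
    exact_mod_cast left_eq_add.1 (by exact_mod_cast h)
  let w : AddValuation L (WithTop ℤ) :=
    AddValuation.of v ((hv0 0).2 rfl) hv1 hvadd hvmul
  have hw : ∀ (a : ℤ) (z : L), ValEq w a z ↔ v z = a := fun _ _ => Iff.rfl
  have hyL : ∀ i, y.coeff i ∈ L := fun i =>
    hL ▸ IntermediateField.subset_adjoin _ _ (Set.mem_range_self i)
  let x : WittVector p K := WittVector.mk p fun i => if h : i < n then u.coeff ⟨i, h⟩ else 0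
  let y' : WittVector p L :=
    WittVector.mk p fun i => if h : i < n then ⟨y.coeff ⟨i, h⟩, hyL _⟩ else 0
  have hx : ∀ i : Fin n, x.coeff i = u.coeff i := fun i => by simp [x]
  have hy' : ∀ i : Fin n, y'.coeff i = ⟨y.coeff i, hyL i⟩ := fun i => by simp [y']
  have hyt : WittVector.truncate n (WittVector.map (algebraMap L Ω) y') = y := by
    ext i
    rw [WittVector.coeff_truncate, WittVector.map_coeff, hy']
    rfl
  have hyF : WittVector.truncate n (WittVector.frobenius (WittVector.map (algebraMap L Ω) y')) =
      twFrobenius p n y := by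
    ext i
    rw [WittVector.coeff_truncate, WittVector.coeff_frobenius_charP, ← hyt, twFrobenius,
      TruncatedWittVector.coeff_mk, WittVector.coeff_truncate]
  have hxu : WittVector.truncate n (WittVector.map (algebraMap K Ω) x) =
      twMap p n (algebraMap K Ω) u := by
    ext i
    rw [WittVector.coeff_truncate, WittVector.map_coeff, hx, twMap, TruncatedWittVector.coeff_mk]
  have heq : WittVector.truncate n (WittVector.frobenius y' - y') =
      WittVector.truncate n (WittVector.map (algebraMap K L) x) := by
    refine truncate_eq_of_map_eq (algebraMap L Ω).injective ?_
    have h1 : WittVector.map (algebraMap L Ω) (WittVector.map (algebraMap K L) x) =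
        WittVector.map (algebraMap K Ω) x := by
      ext i
      simp only [WittVector.map_coeff]
      rfl
    rw [h1, hxu, map_sub (WittVector.map _), ← frobenius_map, map_sub (WittVector.truncate n),
      hyF, hyt, hy]
  have hgen : ∀ σ τ : L ≃ₐ[K] L, (∀ i < n, σ (y'.coeff i) = τ (y'.coeff i)) → σ = τ := by
    intro σ τ h
    refine IntermediateField.algEquiv_ext_of_adjoin hL ?_
    rintro z ⟨i, hi⟩
    have h1 := h i i.2
    rwa [hy', show (⟨y.coeff i, hyL i⟩ : L) = z from Subtype.ext hi] at h1
  set M := Finset.univ.sup fun i : Fin n => p ^ (n - 1 - i.val) * ν i with hM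
  obtain ⟨a, i, hi, hia, ⟨τ, hτ, hiτ⟩, hsum⟩ := exists_largest_break (w := w) (t := t) ι hn hdeg
    ((hw _ _).2 ht) (fun x hx => (hw _ _).2 (by rw [hvK x hx]; push_cast; rfl)) hν hνp
    (fun i => by rw [hx]; exact ⟨hu i, hord i⟩) heq hgen hM
  have hG : ∀ j : ℕ, ramGroup (K := K) v t j = {σ | σ = 1 ∨ (j : ℤ) + 1 ≤ i σ} := by
    intro j
    ext σ
    by_cases hσ : σ = 1
    · simp [ramGroup, hσ, (hv0 0).2 rfl]
    · simp only [ramGroup, Set.mem_ofPred_eq, hσ, false_or]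
      rw [(hw _ _).1 (hi σ hσ), WithTop.coe_le_coe]
  have hea : a = e := by
    refine le_antisymm (not_lt.1 fun hlt => hτ ?_) (not_lt.1 fun hlt => he ?_)
    · have h1 : τ ∈ ramGroup (K := K) v t (e + 1) := by
        rw [hG]
        exact Or.inr (by rw [hiτ]; push_cast; linarith)
      rwa [he' _ e.lt_succ_self] at h1
    · rw [hG]
      ext σ
      simp only [Set.mem_ofPred_eq, Set.mem_singleton_iff, or_iff_left_iff_imp]
      intro h1
      by_contra hσ
      linarith [(hia σ hσ).2]
  subst hea
  simp only [hG] at hm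
  rw [sum_ncard_upper e i fun σ hσ => ⟨by linarith [(hia σ hσ).1], (hia σ hσ).2⟩, hsum] at hm
  have hp0 : ((p : ℤ) ^ n) ≠ 0 := pow_ne_zero _ (by exact_mod_cast (Fact.out : p.Prime).ne_zero)
  have h1 : m + 1 = M + 1 := mul_right_cancel₀ hp0 (by linarith)
  exact add_right_cancel h1
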